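/- Suppose W, Z ⊆ ℕ satisfy W ≰_T Z, and f : [ℕ]^4 → ℕ is a 2-bounded coloring computable relative to an oracle for Z. Then there exists an infinite tail f-rainbow X such that W ≰_T X ⊕ Z. -/

import Mathlib

namespace RRT

/-- Partial functions on ℕ that are recursive in the oracle `O`.
This mirrors `Nat.Partrec`, with an extra constructor for the oracle. -/
inductive RecursiveIn (O : ℕ →. ℕ) : (ℕ →. ℕ) → Prop
  | zero : RecursiveIn O (pure 0)
  | succ : RecursiveIn O Nat.succ
  | left : RecursiveIn O ↑fun n : ℕ => n.unpair.1
  | right : RecursiveIn O ↑fun n : ℕ => n.unpair.2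
  | oracle : RecursiveIn O O
  | pair {f g} : RecursiveIn O f → RecursiveIn O g →
      RecursiveIn O fun n => Nat.pair <$> f n <*> g n
  | comp {f g} : RecursiveIn O f → RecursiveIn O g →
      RecursiveIn O fun n => g n >>= f
  | prec {f g} : RecursiveIn O f → RecursiveIn O g →
      RecursiveIn O (Nat.unpaired fun a n =>
        n.rec (f a) fun y IH => do let i ← IH; g (Nat.pair a (Nat.pair y i)))
  | rfind {f} : RecursiveIn O f →
      RecursiveIn O fun a => Nat.rfind fun n => (fun m => m = 0) <$> f (Nat.pair a n)

/-- The characteristic function of a set of naturals. -/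
noncomputable def chi (A : Set ℕ) : ℕ → ℕ := A.indicator fun _ => 1

/-- Turing reducibility `A ≤_T B` for sets of naturals: the characteristic function of `A`
is computable relative to an oracle for the characteristic function of `B`. -/
def TuringLE (A B : Set ℕ) : Prop := RecursiveIn (chi B) (chi A)

/-- The recursive join `A ⊕ B = {2n : n ∈ A} ∪ {2n+1 : n ∈ B}`. -/
def join (A B : Set ℕ) : Set ℕ :=
  {n : ℕ | (∃ m ∈ A, n = 2 * m) ∨ (∃ m ∈ B, n = 2 * m + 1)}

/-- A total function `f : ℕ → ℕ` is computable relative to an oracle for `Z ⊆ ℕ`. -/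
def FunRecIn (Z : Set ℕ) (f : ℕ → ℕ) : Prop := RecursiveIn (chi Z) f


/-- A coloring of `[ℕ]⁴` (identified with strictly increasing quadruples) is 2-bounded if
every color has at most 2 preimages. -/
def Bounded2Quads (f : ℕ → ℕ → ℕ → ℕ → ℕ) : Prop :=
  ∀ c : ℕ, {t : ℕ × ℕ × ℕ × ℕ | t.1 < t.2.1 ∧ t.2.1 < t.2.2.1 ∧ t.2.2.1 < t.2.2.2 ∧
    f t.1 t.2.1 t.2.2.1 t.2.2.2 = c}.encard ≤ 2

/-- `X` is a tail `f`-rainbow for a coloring of quadruples: quadruples from `X` with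
distinct last-three coordinates get distinct colors. -/
def TailRainbow4On (f : ℕ → ℕ → ℕ → ℕ → ℕ) (X : Set ℕ) : Prop :=
  ∀ x₀ x₁ x₂ x₃ y₀ y₁ y₂ y₃ : ℕ,
    x₀ ∈ X → x₁ ∈ X → x₂ ∈ X → x₃ ∈ X → y₀ ∈ X → y₁ ∈ X → y₂ ∈ X → y₃ ∈ X →
    x₀ < x₁ → x₁ < x₂ → x₂ < x₃ → y₀ < y₁ → y₁ < y₂ → y₂ < y₃ →
    (x₁, x₂, x₃) ≠ (y₁, y₂, y₃) → f x₀ x₁ x₂ x₃ ≠ f y₀ y₁ y₂ y₃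


open Classical in
/-- The initial segment of length `m` of (the characteristic function of) `A`. -/
noncomputable def res (A : Set ℕ) (m : ℕ) : List Bool :=
  (List.range m).map fun i => decide (i ∈ A)

theorem res_length (A : Set ℕ) (m : ℕ) : (res A m).length = m := by simp [res]

open Classical in
theorem res_get (A : Set ℕ) (m i : ℕ) :
    (res A m)[i]? = if i < m then some (decide (i ∈ A)) else none := by
  unfold res
  split_ifs with h
  · simp [h]
  · simp [h]

theorem res_get_true {A : Set ℕ} {m i : ℕ} :
    (res A m)[i]? = some true ↔ i < m ∧ i ∈ A := by
  rw [res_get]; split_ifs with h <;> simp [h]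

theorem res_get_false {A : Set ℕ} {m i : ℕ} :
    (res A m)[i]? = some false ↔ i < m ∧ i ∉ A := by
  rw [res_get]; split_ifs with h <;> simp [h]

theorem res_take (A : Set ℕ) {m i : ℕ} (h : i ≤ m) : (res A m).take i = res A i := by
  apply List.ext_getElem?
  intro j
  rw [List.getElem?_take]
  rw [res_get, res_get]
  split_ifs <;> first | rfl | omega

theorem res_mono_pfx (A : Set ℕ) {m m' : ℕ} (h : m ≤ m') : res A m <+: res A m' := by
  rw [← res_take A h]; exact ⟨_, List.take_append_drop _ _⟩

theorem res_congr {A A' : Set ℕ} {m : ℕ} (h : ∀ i < m, (i ∈ A ↔ i ∈ A')) :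
    res A m = res A' m := by
  apply List.ext_getElem?
  intro j
  rw [res_get, res_get]
  split_ifs with hj
  · simp [h j hj]
  · rfl

theorem eq_res {A : Set ℕ} {σ : List Bool}
    (h : ∀ i < σ.length, (σ[i]? = some true ∧ i ∈ A) ∨ (σ[i]? = some false ∧ i ∉ A)) :
    σ = res A σ.length := by
  apply List.ext_getElem?
  intro j
  by_cases hj : j < σ.length
  · rcases h j hj with ⟨h1, h2⟩ | ⟨h1, h2⟩
    · rw [h1, eq_comm, res_get_true]; exact ⟨hj, h2⟩
    · rw [h1, eq_comm, res_get_false]; exact ⟨hj, h2⟩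
  · rw [res_get, if_neg hj]; simpa using hj

/-- `Q` is uniformly `Σ⁰₁` relative to the oracle `q γ`. -/
def Sig {Γ α : Type*} [Primcodable α] (q : Γ → Set ℕ) (Q : α → Γ → Prop) : Prop :=
  ∃ D : α → List Bool → Prop, PrimrecRel D ∧ (∀ a σ τ, σ <+: τ → D a σ → D a τ) ∧
    ∀ a γ, Q a γ ↔ ∃ m, D a (res (q γ) m)

section
variable {Γ Γ' α β : Type*} [Primcodable α] [Primcodable β] {q : Γ → Set ℕ} {q' : Γ' → Set ℕ}

theorem Sig.of {Q : α → Γ → Prop} (D : α → List Bool → Prop) (hD : PrimrecRel D)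
    (h : ∀ a γ, Q a γ ↔ ∃ m, D a (res (q γ) m)) : Sig q Q := by
  refine ⟨fun a σ => ∃ i < σ.length + 1, D a (σ.take i), ?_, ?_, ?_⟩
  · have : PrimrecRel fun (i : ℕ) (p : α × List Bool) => D p.1 (p.2.take i) :=
      PrimrecRel.comp hD (Primrec.fst.comp Primrec.snd)
        (Primrec.list_take.comp Primrec.fst (Primrec.snd.comp Primrec.snd))
    exact (PrimrecRel.comp this.exists_mem_list
      (f := fun p : α × List Bool => List.range (p.2.length + 1))
      (g := fun p => p) (Primrec.list_range.comp
        (Primrec.succ.comp (Primrec.list_length.comp Primrec.snd))) Primrec.id).of_eq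
      fun p => by simp
  · rintro a σ τ ⟨ρ, rfl⟩ ⟨i, hi, hd⟩
    refine ⟨i, by simp; omega, ?_⟩
    rwa [List.take_append_of_le_length (by omega)]
  · intro a γ
    rw [h]
    constructor
    · rintro ⟨m, hm⟩
      refine ⟨m, m, by simp [res_length], ?_⟩
      rwa [res_take _ le_rfl]
    · rintro ⟨m, i, hi, hd⟩
      rw [res_length] at hi
      rw [res_take _ (by omega)] at hd
      exact ⟨i, hd⟩

theorem Sig.congr {Q Q' : α → Γ → Prop} (h : Sig q Q) (e : ∀ a γ, Q' a γ ↔ Q a γ) :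
    Sig q Q' := by
  obtain ⟨D, h1, h2, h3⟩ := h
  exact ⟨D, h1, h2, fun a γ => (e a γ).trans (h3 a γ)⟩

theorem Sig.prim {p : α → Prop} (hp : PrimrecPred p) : Sig q fun a _ => p a :=
  ⟨fun a _ => p a, hp.comp Primrec.fst, fun _ _ _ _ h => h, fun a γ => by simp⟩

theorem Sig.const (p : Prop) : Sig q fun (_ : α) _ => p := by
  by_cases h : p
  · exact (Sig.prim (p := fun _ : α => (0 : ℕ) = 0)
      (Primrec.eq.comp (Primrec.const 0) (Primrec.const 0))).congr (by simp [h])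
  · exact (Sig.prim (p := fun _ : α => (0 : ℕ) = 1)
      (Primrec.eq.comp (Primrec.const 0) (Primrec.const 1))).congr (by simp [h])

theorem Sig.mem {f : α → ℕ} (hf : Primrec f) : Sig q fun a γ => f a ∈ q γ := by
  refine Sig.of (fun a σ => σ[f a]? = some true) ?_ ?_
  · exact Primrec.eq.comp (Primrec.list_getElem?.comp Primrec.snd (hf.comp Primrec.fst))
      (Primrec.const _)
  · intro a γ
    simp only [res_get_true]
    exact ⟨fun h => ⟨f a + 1, by omega, h⟩, fun ⟨_, _, h⟩ => h⟩

theorem Sig.not_mem {f : α → ℕ} (hf : Primrec f) : Sig q fun a γ => f a ∉ q γ := by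
  refine Sig.of (fun a σ => σ[f a]? = some false) ?_ ?_
  · exact Primrec.eq.comp (Primrec.list_getElem?.comp Primrec.snd (hf.comp Primrec.fst))
      (Primrec.const _)
  · intro a γ
    simp only [res_get_false]
    exact ⟨fun h => ⟨f a + 1, by omega, h⟩, fun ⟨_, _, h⟩ => h⟩

theorem Sig.and {Q Q' : α → Γ → Prop} (h : Sig q Q) (h' : Sig q Q') :
    Sig q fun a γ => Q a γ ∧ Q' a γ := by
  obtain ⟨D, h1, h2, h3⟩ := h
  obtain ⟨D', h1', h2', h3'⟩ := h'
  refine ⟨fun a σ => D a σ ∧ D' a σ, PrimrecPred.and h1 h1',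
    fun a σ τ hs h => ⟨h2 a σ τ hs h.1, h2' a σ τ hs h.2⟩, fun a γ => ?_⟩
  beta_reduce
  rw [h3, h3']
  constructor
  · rintro ⟨⟨m, hm⟩, ⟨m', hm'⟩⟩
    exact ⟨max m m', h2 _ _ _ (res_mono_pfx _ (le_max_left _ _)) hm,
      h2' _ _ _ (res_mono_pfx _ (le_max_right _ _)) hm'⟩
  · rintro ⟨m, hm, hm'⟩
    exact ⟨⟨m, hm⟩, ⟨m, hm'⟩⟩

theorem Sig.or {Q Q' : α → Γ → Prop} (h : Sig q Q) (h' : Sig q Q') :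
    Sig q fun a γ => Q a γ ∨ Q' a γ := by
  obtain ⟨D, h1, h2, h3⟩ := h
  obtain ⟨D', h1', h2', h3'⟩ := h'
  refine ⟨fun a σ => D a σ ∨ D' a σ, PrimrecPred.or h1 h1',
    fun a σ τ hs h => h.imp (h2 a σ τ hs) (h2' a σ τ hs), fun a γ => ?_⟩
  beta_reduce
  rw [h3, h3', ← exists_or]

theorem Sig.comp {Q : β → Γ → Prop} (h : Sig q Q) {f : α → β} (hf : Primrec f) :
    Sig q fun a γ => Q (f a) γ := by
  obtain ⟨D, h1, h2, h3⟩ := h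
  exact ⟨fun a σ => D (f a) σ, PrimrecRel.comp h1 (hf.comp Primrec.fst) Primrec.snd,
    fun a => h2 (f a), fun a => h3 (f a)⟩

theorem Sig.ex {Q : α → β → Γ → Prop} (h : Sig q fun (p : α × β) γ => Q p.1 p.2 γ) :
    Sig q fun a γ => ∃ b, Q a b γ := by
  obtain ⟨D, h1, h2, h3⟩ := h
  refine Sig.of (fun a σ => ∃ b ∈ (List.range σ.length).filterMap (Encodable.decode (α := β)),
    D (a, b) σ) ?_ ?_
  · have : PrimrecRel fun (b : β) (p : α × List Bool) => D (p.1, b) p.2 :=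
      PrimrecRel.comp h1 ((Primrec.fst.comp Primrec.snd).pair Primrec.fst)
        (Primrec.snd.comp Primrec.snd)
    refine PrimrecRel.comp this.exists_mem_list ?_ Primrec.id
    exact Primrec.listFilterMap
      (Primrec.list_range.comp (Primrec.list_length.comp Primrec.snd))
      (Primrec.decode.comp Primrec.snd)
  · intro a γ
    constructor
    · rintro ⟨b, hb⟩
      obtain ⟨m, hm⟩ := (h3 (a, b) γ).1 hb
      refine ⟨max m (Encodable.encode b + 1), b, ?_,
        h2 _ _ _ (res_mono_pfx _ (le_max_left _ _)) hm⟩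
      simp only [List.mem_filterMap, List.mem_range, res_length]
      exact ⟨Encodable.encode b, by omega, by simp⟩
    · rintro ⟨m, b, -, hb⟩
      exact ⟨b, (h3 (a, b) γ).2 ⟨m, hb⟩⟩

theorem Sig.all {Q : α → β → Γ → Prop} (h : Sig q fun (p : α × β) γ => Q p.1 p.2 γ)
    {l : α → List β} (hl : Primrec l) :
    Sig q fun a γ => ∀ b ∈ l a, Q a b γ := by
  obtain ⟨D, h1, h2, h3⟩ := h
  refine ⟨fun a σ => ∀ b ∈ l a, D (a, b) σ, ?_, ?_, ?_⟩
  · have : PrimrecRel fun (b : β) (p : α × List Bool) => D (p.1, b) p.2 :=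
      PrimrecRel.comp h1 ((Primrec.fst.comp Primrec.snd).pair Primrec.fst)
        (Primrec.snd.comp Primrec.snd)
    exact PrimrecRel.comp this.forall_mem_list (hl.comp Primrec.fst) Primrec.id
  · exact fun a σ τ hs h b hb => h2 _ _ _ hs (h b hb)
  · intro a γ
    constructor
    · intro H
      have : ∀ L : List β, (∀ b ∈ L, b ∈ l a) → ∃ m, ∀ b ∈ L, D (a, b) (res (q γ) m) := by
        intro L
        induction L with
        | nil => intro _; exact ⟨0, by simp⟩
        | cons x L ih =>
          intro hL
          obtain ⟨m, hm⟩ := ih fun b hb => hL b (List.mem_cons_of_mem _ hb)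
          obtain ⟨m', hm'⟩ := (h3 (a, x) γ).1 (H x (hL x List.mem_cons_self))
          refine ⟨max m m', ?_⟩
          intro b hb
          rcases List.mem_cons.1 hb with rfl | hb
          · exact h2 _ _ _ (res_mono_pfx _ (le_max_right _ _)) hm'
          · exact h2 _ _ _ (res_mono_pfx _ (le_max_left _ _)) (hm b hb)
      exact this (l a) fun _ h => h
    · rintro ⟨m, hm⟩ b hb
      exact (h3 (a, b) γ).2 ⟨m, hm b hb⟩

theorem Sig.all_lt {Q : α → ℕ → Γ → Prop} (h : Sig q fun (p : α × ℕ) γ => Q p.1 p.2 γ)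
    {l : α → ℕ} (hl : Primrec l) :
    Sig q fun a γ => ∀ b < l a, Q a b γ :=
  (Sig.all h (Primrec.list_range.comp hl)).congr (by simp)

theorem Sig.subst {Q : α → Γ' → Prop} (h : Sig q' Q) (T : α → Γ → Γ')
    (hp : Sig q fun (p : α × ℕ) γ => p.2 ∈ q' (T p.1 γ))
    (hn : Sig q fun (p : α × ℕ) γ => p.2 ∉ q' (T p.1 γ)) :
    Sig q fun a γ => Q a (T a γ) := by
  obtain ⟨D, h1, h2, h3⟩ := h
  have key : Sig q fun a γ => ∃ σ : List Bool, D a σ ∧ ∀ i < σ.length,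
      (σ[i]? = some true ∧ i ∈ q' (T a γ)) ∨ (σ[i]? = some false ∧ i ∉ q' (T a γ)) := by
    apply Sig.ex
    apply Sig.and
    · exact Sig.prim (PrimrecRel.comp h1 Primrec.fst Primrec.snd)
    · refine Sig.all_lt (Q := fun (p : α × List Bool) i γ =>
        (p.2[i]? = some true ∧ i ∈ q' (T p.1 γ)) ∨ (p.2[i]? = some false ∧ i ∉ q' (T p.1 γ)))
        ?_ (Primrec.list_length.comp Primrec.snd)
      have hg : Primrec fun p : (α × List Bool) × ℕ => p.1.2[p.2]? :=
        Primrec.list_getElem?.comp (Primrec.snd.comp Primrec.fst) Primrec.snd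
      have hc : Primrec fun p : (α × List Bool) × ℕ => (p.1.1, p.2) :=
        (Primrec.fst.comp Primrec.fst).pair Primrec.snd
      exact Sig.or
        (Sig.and (Sig.prim (Primrec.eq.comp hg (Primrec.const (some true)))) (hp.comp hc))
        (Sig.and (Sig.prim (Primrec.eq.comp hg (Primrec.const (some false)))) (hn.comp hc))
  refine key.congr fun a γ => ?_
  rw [h3]
  constructor
  · rintro ⟨m, hm⟩
    refine ⟨_, hm, fun i hi => ?_⟩
    rw [res_length] at hi
    by_cases h : i ∈ q' (T a γ)
    · exact Or.inl ⟨res_get_true.2 ⟨hi, h⟩, h⟩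
    · exact Or.inr ⟨res_get_false.2 ⟨hi, h⟩, h⟩
  · rintro ⟨σ, hd, hσ⟩
    refine ⟨σ.length, ?_⟩
    rwa [← eq_res hσ]

end

/-- `A` is computable from `B` (both `A` and its complement are c.e. in `B`). -/
def Red (A B : Set ℕ) : Prop :=
  Sig (fun _ : Unit => B) (fun (n : ℕ) _ => n ∈ A) ∧
  Sig (fun _ : Unit => B) (fun (n : ℕ) _ => n ∉ A)

/-- `V` is not c.e. in `B`. -/
def Avoid (V B : Set ℕ) : Prop := ¬ Sig (fun _ : Unit => B) (fun (n : ℕ) _ => n ∈ V)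

theorem Sig.red {α : Type*} [Primcodable α] {A B : Set ℕ} {Q : α → Prop}
    (h : Sig (fun _ : Unit => A) fun a _ => Q a) (hr : Red A B) :
    Sig (fun _ : Unit => B) fun a _ => Q a :=
  Sig.subst (Q := fun a (_ : Unit) => Q a) h (fun _ _ => ())
    (hr.1.comp Primrec.snd) (hr.2.comp Primrec.snd)

theorem Avoid.mono {V A B : Set ℕ} (h : Avoid V B) (hr : Red A B) : Avoid V A :=
  fun h' => h (h'.red hr)

theorem Red.trans {A B C : Set ℕ} (h : Red A B) (h' : Red B C) : Red A C :=
  ⟨h.1.red h', h.2.red h'⟩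

theorem Red.refl (A : Set ℕ) : Red A A := ⟨Sig.mem Primrec.id, Sig.not_mem Primrec.id⟩

theorem mem_join {A B : Set ℕ} {n : ℕ} :
    n ∈ join A B ↔ (n % 2 = 0 ∧ n / 2 ∈ A) ∨ (n % 2 = 1 ∧ n / 2 ∈ B) := by
  unfold join
  constructor
  · rintro (⟨m, hm, rfl⟩ | ⟨m, hm, rfl⟩)
    · left; refine ⟨by omega, ?_⟩; rwa [show 2 * m / 2 = m by omega]
    · right; refine ⟨by omega, ?_⟩; rwa [show (2 * m + 1) / 2 = m by omega]
  · rintro (⟨h1, h2⟩ | ⟨h1, h2⟩)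
    · left; exact ⟨_, h2, by omega⟩
    · right; exact ⟨_, h2, by omega⟩

theorem not_mem_join {A B : Set ℕ} {n : ℕ} :
    n ∉ join A B ↔ (n % 2 = 0 ∧ n / 2 ∉ A) ∨ (n % 2 = 1 ∧ n / 2 ∉ B) := by
  rw [mem_join]
  rcases Nat.mod_two_eq_zero_or_one n with h | h <;> simp [h]

theorem mem_join_left {A B : Set ℕ} {n : ℕ} : 2 * n ∈ join A B ↔ n ∈ A := by
  rw [mem_join]; simp

theorem mem_join_right {A B : Set ℕ} {n : ℕ} : 2 * n + 1 ∈ join A B ↔ n ∈ B := by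
  rw [mem_join]; simp [Nat.add_mod, show (2 * n + 1) / 2 = n by omega]

section
variable {Γ α : Type*} [Primcodable α] {q : Γ → Set ℕ}

/-- uniform computability of a family of sets -/
def Dec (q : Γ → Set ℕ) (T : α → Γ → Set ℕ) : Prop :=
  Sig q (fun (p : α × ℕ) γ => p.2 ∈ T p.1 γ) ∧ Sig q (fun (p : α × ℕ) γ => p.2 ∉ T p.1 γ)

theorem Dec.mem {T : α → Γ → Set ℕ} (h : Dec q T) {f : α → ℕ} (hf : Primrec f) :
    Sig q fun a γ => f a ∈ T a γ := h.1.comp (Primrec.id.pair hf)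

theorem Dec.not_mem {T : α → Γ → Set ℕ} (h : Dec q T) {f : α → ℕ} (hf : Primrec f) :
    Sig q fun a γ => f a ∉ T a γ := h.2.comp (Primrec.id.pair hf)

theorem Dec.comp {β : Type*} [Primcodable β] {T : α → Γ → Set ℕ} (h : Dec q T) {f : β → α}
    (hf : Primrec f) : Dec q fun b γ => T (f b) γ :=
  ⟨h.1.comp ((hf.comp Primrec.fst).pair Primrec.snd),
   h.2.comp ((hf.comp Primrec.fst).pair Primrec.snd)⟩

theorem Dec.id : Dec q fun (_ : α) γ => q γ :=
  ⟨Sig.mem Primrec.snd, Sig.not_mem Primrec.snd⟩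

theorem Dec.ofList {f : α → List ℕ} (hf : Primrec f) : Dec q fun a _ => {x | x ∈ f a} := by
  have : PrimrecPred fun p : α × ℕ => p.2 ∈ f p.1 := by
    have h : PrimrecRel fun (x : ℕ) (y : ℕ) => x = y := Primrec.eq
    exact (PrimrecRel.comp h.exists_mem_list (hf.comp Primrec.fst) Primrec.snd).of_eq (by simp)
  exact ⟨Sig.prim this, Sig.prim this.not⟩

theorem Dec.join {S T : α → Γ → Set ℕ} (hS : Dec q S) (hT : Dec q T) :
    Dec q fun a γ => join (S a γ) (T a γ) := by
  have hm : Primrec fun p : α × ℕ => p.2 % 2 := Primrec.nat_mod.comp Primrec.snd (Primrec.const 2)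
  have hd : Primrec fun p : α × ℕ => (p.1, p.2 / 2) :=
    Primrec.fst.pair (Primrec.nat_div.comp Primrec.snd (Primrec.const 2))
  have h0 := Sig.prim (q := q) (Primrec.eq.comp hm (Primrec.const 0))
  have h1 := Sig.prim (q := q) (Primrec.eq.comp hm (Primrec.const 1))
  exact ⟨(Sig.or (h0.and (hS.1.comp hd)) (h1.and (hT.1.comp hd))).congr fun _ _ => mem_join,
    (Sig.or (h0.and (hS.2.comp hd)) (h1.and (hT.2.comp hd))).congr fun _ _ => not_mem_join⟩

theorem Dec.left {A B : Γ → Set ℕ} (h : Dec q fun (_ : α) γ => RRT.join (A γ) (B γ)) :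
    Dec q fun (_ : α) γ => A γ :=
  ⟨(h.1.comp (Primrec.fst.pair (Primrec.nat_double.comp Primrec.snd))).congr
      fun _ _ => mem_join_left.symm,
   (h.2.comp (Primrec.fst.pair (Primrec.nat_double.comp Primrec.snd))).congr
      fun _ _ => not_congr mem_join_left.symm⟩

theorem Dec.right {A B : Γ → Set ℕ} (h : Dec q fun (_ : α) γ => RRT.join (A γ) (B γ)) :
    Dec q fun (_ : α) γ => B γ :=
  ⟨(h.1.comp (Primrec.fst.pair (Primrec.nat_double_succ.comp Primrec.snd))).congr
      fun _ _ => mem_join_right.symm,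
   (h.2.comp (Primrec.fst.pair (Primrec.nat_double_succ.comp Primrec.snd))).congr
      fun _ _ => not_congr mem_join_right.symm⟩

theorem Dec.union {S T : α → Γ → Set ℕ} (hS : Dec q S) (hT : Dec q T) :
    Dec q fun a γ => S a γ ∪ T a γ :=
  ⟨(hS.1.or hT.1).congr fun _ _ => Iff.rfl,
   (hS.2.and hT.2).congr fun _ _ => by simp⟩

theorem Dec.inter {S T : α → Γ → Set ℕ} (hS : Dec q S) (hT : Dec q T) :
    Dec q fun a γ => S a γ ∩ T a γ :=
  ⟨(hS.1.and hT.1).congr fun _ _ => Iff.rfl,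
   (hS.2.or hT.2).congr fun _ _ => by
    simp only [Set.mem_inter_iff]; tauto⟩

theorem Dec.compl {S : α → Γ → Set ℕ} (hS : Dec q S) : Dec q fun a γ => (S a γ)ᶜ :=
  ⟨hS.2.congr fun _ _ => Iff.rfl, hS.1.congr fun _ _ => by simp⟩

theorem Sig.subst' {Γ' : Type*} {q' : Γ' → Set ℕ} {Q : α → Γ' → Prop} (h : Sig q' Q)
    (T : α → Γ → Γ') (hT : Dec q fun a γ => q' (T a γ)) : Sig q fun a γ => Q a (T a γ) :=
  h.subst T hT.1 hT.2

end

theorem Dec.red {A B : Set ℕ} (h : Dec (fun _ : Unit => B) fun (_ : Unit) _ => A) : Red A B :=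
  ⟨h.1.comp ((Primrec.const ()).pair Primrec.id), h.2.comp ((Primrec.const ()).pair Primrec.id)⟩

theorem Red.dec {Γ α : Type*} [Primcodable α] {q : Γ → Set ℕ} {A B : Set ℕ} (h : Red A B)
    (hB : Dec q fun (_ : α) _ => B) : Dec q fun (_ : α) _ => A := by
  have h1 : Sig (fun _ : Unit => B) fun (p : α × ℕ) _ => p.2 ∈ A := h.1.comp Primrec.snd
  have h2 : Sig (fun _ : Unit => B) fun (p : α × ℕ) _ => p.2 ∉ A := h.2.comp Primrec.snd
  have hB' := hB.comp (Primrec.fst (α := α) (β := ℕ))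
  exact ⟨h1.subst' (fun _ _ => ()) hB', h2.subst' (fun _ _ => ()) hB'⟩

theorem red_join_left (A B : Set ℕ) : Red A (join A B) :=
  Dec.red (Dec.left (A := fun _ => A) (B := fun _ => B) Dec.id)

theorem red_join_right (A B : Set ℕ) : Red B (join A B) :=
  Dec.red (Dec.right (A := fun _ => A) (B := fun _ => B) Dec.id)

theorem Red.join {A B C : Set ℕ} (h : Red A C) (h' : Red B C) : Red (join A B) C :=
  Dec.red (Dec.join (h.dec Dec.id) (h'.dec Dec.id))

theorem Red.inter {A B C : Set ℕ} (h : Red A C) (h' : Red B C) : Red (A ∩ B) C :=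
  Dec.red (Dec.inter (h.dec Dec.id) (h'.dec Dec.id))

theorem Red.compl {A C : Set ℕ} (h : Red A C) : Red Aᶜ C :=
  Dec.red (Dec.compl (h.dec Dec.id))

theorem red_gt (k : ℕ) (C : Set ℕ) : Red {x | k < x} C :=
  ⟨Sig.prim (Primrec.nat_lt.comp (Primrec.const k) Primrec.id),
   (Sig.prim (Primrec.nat_lt.comp (Primrec.const k) Primrec.id).not).congr fun _ _ => Iff.rfl⟩



theorem generic_seq {C : Type*} (le : C → C → Prop) (Req : ℕ → C → Prop)
    (h : ∀ k c, ∃ c', le c' c ∧ Req k c') (c0 : C) :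
    ∃ s : ℕ → C, s 0 = c0 ∧ ∀ k, le (s (k + 1)) (s k) ∧ Req k (s (k + 1)) := by
  choose nxt hn using h
  exact ⟨fun k => Nat.rec c0 (fun k c => nxt k c) k, rfl, fun k => hn k _⟩

theorem exists_enum : ∃ e : ℕ → (ℕ → List Bool → Prop), ∀ D, PrimrecRel D → ∃ k, e k = D := by
  have hex : ∀ D : ℕ → List Bool → Prop, PrimrecRel D → ∃ c : Nat.Partrec.Code,
      ∀ n σ, D n σ ↔ Encodable.encode (some true) ∈ c.eval (Encodable.encode (n, σ)) := by
    rintro D ⟨_, hD⟩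
    have hD' : Nat.Primrec _ := hD
    obtain ⟨c, hc⟩ := Nat.Partrec.Code.exists_code.1 (Nat.Partrec.of_primrec hD')
    refine ⟨c, fun n σ => ?_⟩
    rw [congrFun hc (Encodable.encode (n, σ))]
    change _ ↔ _ ∈ Part.some _
    rw [Part.mem_some_iff, Encodable.encode_inj]
    simp [eq_comm]
  refine ⟨fun k n σ => Encodable.encode (some true) ∈
    (Denumerable.ofNat Nat.Partrec.Code k).eval (Encodable.encode (n, σ)), ?_⟩
  intro D hD
  obtain ⟨c, hc⟩ := hex D hD
  refine ⟨Encodable.encode c, ?_⟩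
  funext n σ
  apply propext
  refine Iff.trans ?_ (hc n σ).symm
  have := Denumerable.ofNat_encode c
  constructor
  · intro h
    change _ ∈ (Denumerable.ofNat Nat.Partrec.Code (Encodable.encode c)).eval _ at h
    rwa [this] at h
  · intro h
    change _ ∈ (Denumerable.ofNat Nat.Partrec.Code (Encodable.encode c)).eval _
    rwa [this]

/-- the set coded by a Boolean sequence -/
def bset (b : ℕ → Bool) : Set ℕ := {i | b i = true}

theorem bset_surj (A : Set ℕ) : ∃ b, bset b = A := by
  classical
  exact ⟨fun i => decide (i ∈ A), by ext; simp [bset]⟩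

theorem isOpen_res (B : Set ℕ) (p : List Bool → Prop) (m : ℕ) :
    IsOpen {b : ℕ → Bool | p (res (join (bset b) B) m)} := by
  rw [isOpen_iff_mem_nhds]
  intro b hb
  have : Set.pi (↑(Finset.range m)) (fun i => ({b i} : Set Bool)) ∈ nhds b := by
    apply IsOpen.mem_nhds
    · exact isOpen_set_pi (Finset.finite_toSet _) fun _ _ => isOpen_discrete _
    · intro i _; simp
  refine Filter.mem_of_superset this fun b' hb' => ?_
  have e : res (join (bset b') B) m = res (join (bset b) B) m := by
    apply res_congr
    intro i hi
    have h2 : b' (i / 2) = b (i / 2) := by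
      have := hb' (i / 2) (by simp; omega)
      simpa using this
    rw [mem_join, mem_join]
    simp [bset, h2]
  simp only [Set.mem_ofPred_eq] at hb ⊢
  rwa [e]

/-- all Boolean lists of length `m` -/
def allB (m : ℕ) : List (List Bool) :=
  Nat.rec [[]] (fun _ L => L.flatMap fun l => [false :: l, true :: l]) m

theorem mem_allB {m : ℕ} {l : List Bool} (h : l.length = m) : l ∈ allB m := by
  induction m generalizing l with
  | zero => simp [allB, List.length_eq_zero_iff.1 h]
  | succ m ih =>
    cases l with
    | nil => simp at h
    | cons x l =>
      have := ih (l := l) (by simpa using h)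
      change x :: l ∈ (allB m).flatMap fun l => [false :: l, true :: l]
      rw [List.mem_flatMap]
      refine ⟨l, this, ?_⟩
      cases x <;> simp

theorem length_of_mem_allB {m : ℕ} {l : List Bool} (h : l ∈ allB m) : l.length = m := by
  induction m generalizing l with
  | zero => simp [allB] at h; simp [h]
  | succ m ih =>
    change l ∈ (allB m).flatMap fun l => [false :: l, true :: l] at h
    rw [List.mem_flatMap] at h
    obtain ⟨l', h1, h2⟩ := h
    have := ih h1
    simp at h2
    rcases h2 with rfl | rfl <;> simp [this]

theorem primrec_allB : Primrec allB := by
  refine Primrec.nat_rec₁ (f := fun (_ : ℕ) (L : List (List Bool)) =>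
    L.flatMap fun l => [false :: l, true :: l]) _ ?_
  refine Primrec.list_flatMap Primrec.snd ?_
  refine Primrec.list_cons.comp (Primrec.list_cons.comp (Primrec.const false) Primrec.snd) ?_
  exact Primrec.list_cons.comp (Primrec.list_cons.comp (Primrec.const true) Primrec.snd)
    (Primrec.const [])

/-- interleaving -/
def ilv (τ β : List Bool) : List Bool :=
  (List.range (2 * β.length)).map fun i =>
    bif i % 2 == 0 then τ.getD (i / 2) false else β.getD (i / 2) false

theorem primrec_ilv : Primrec₂ ilv := by
  have hi : Primrec fun p : (List Bool × List Bool) × ℕ => p.2 / 2 :=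
    Primrec.nat_div.comp Primrec.snd (Primrec.const 2)
  refine Primrec.list_map (Primrec.list_range.comp
    (Primrec.nat_double.comp (Primrec.list_length.comp Primrec.snd))) ?_
  refine Primrec.cond (Primrec.beq.comp (Primrec.nat_mod.comp Primrec.snd (Primrec.const 2))
    (Primrec.const 0)) ?_ ?_
  · exact (Primrec.list_getD false).comp (Primrec.fst.comp Primrec.fst) hi
  · exact (Primrec.list_getD false).comp (Primrec.snd.comp Primrec.fst) hi

theorem ilv_res (R B : Set ℕ) (m : ℕ) : ilv (res R m) (res B m) = res (join R B) (2 * m) := by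
  classical
  unfold ilv
  rw [res_length]
  unfold res
  apply List.map_congr_left
  intro i hi
  have hi : i / 2 < m := by simp at hi; omega
  simp only [mem_join]
  rcases Nat.mod_two_eq_zero_or_one i with h | h <;> simp [h, List.getD, hi]

theorem Sig.compact {α : Type*} [Primcodable α] {B : Set ℕ} {P : α → Set ℕ → Prop}
    (h : Sig (fun R => join R B) P) : Sig (fun _ : Unit => B) fun a _ => ∀ R, P a R := by
  obtain ⟨D, h1, h2, h3⟩ := h
  refine Sig.of (fun a β => ∀ τ ∈ allB β.length, D a (ilv τ β)) ?_ ?_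
  · have : PrimrecRel fun (τ : List Bool) (p : α × List Bool) => D p.1 (ilv τ p.2) :=
      PrimrecRel.comp h1 (Primrec.fst.comp Primrec.snd)
        (primrec_ilv.comp Primrec.fst (Primrec.snd.comp Primrec.snd))
    exact PrimrecRel.comp this.forall_mem_list
      (primrec_allB.comp (Primrec.list_length.comp Primrec.snd)) Primrec.id
  · intro a _
    simp only [res_length]
    constructor
    · intro H
      obtain ⟨m, hm⟩ := (isCompact_univ (X := ℕ → Bool)).elim_directed_cover
        (fun m => {b : ℕ → Bool | D a (res (join (bset b) B) (2 * m))})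
        (fun m => isOpen_res B _ _)
        (fun b _ => by
          obtain ⟨m, hm⟩ := (h3 a (bset b)).1 (H (bset b))
          exact Set.mem_iUnion.2 ⟨m, h2 _ _ _ (res_mono_pfx _ (by omega)) hm⟩)
        (Monotone.directed_le fun m m' hmm b hb =>
          h2 _ _ _ (res_mono_pfx _ (by omega)) hb)
      refine ⟨m, fun τ hτ => ?_⟩
      have hl := length_of_mem_allB hτ
      have e : τ = res (bset fun i => τ.getD i false) m := by
        rw [← hl]
        apply eq_res
        intro i hi
        by_cases hb : τ[i]
        · left; simp [bset, List.getD, hi, hb]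
        · right; simp [bset, List.getD, hi, hb]
      rw [e, ilv_res]
      exact hm (Set.mem_univ _)
    · rintro ⟨m, hm⟩ R
      have := hm (res R m) (mem_allB (res_length _ _))
      rw [ilv_res] at this
      exact (h3 a R).2 ⟨_, this⟩

/-- Cone avoidance basis theorem. -/
theorem basis {V B : Set ℕ} (hB : Avoid V B) {P : Set ℕ → Prop}
    (hP : Sig (fun R => join R B) fun (_ : Unit) R => P R) (hne : ∃ R, ¬ P R) :
    ∃ R, ¬ P R ∧ Avoid V (join R B) := by
  obtain ⟨e, he⟩ := exists_enum
  let C := {P : Set ℕ → Prop // (Sig (fun R => join R B) fun (_ : Unit) R => P R) ∧ ∃ R, ¬ P R}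
  obtain ⟨s, hs0, hs⟩ := generic_seq (C := C) (fun c' c => ∀ R, c.1 R → c'.1 R)
    (fun k c => ∀ R, ¬ c.1 R → PrimrecRel (e k) →
      ¬ ∀ n, n ∈ V ↔ ∃ m, e k n (res (join R B) m)) (by
    rintro k ⟨P, hP, hne⟩
    by_cases hk : PrimrecRel (e k)
    swap
    · exact ⟨⟨P, hP, hne⟩, fun _ h => h, fun _ _ h => absurd h hk⟩
    have hS : Sig (fun R => join R B) fun n R => ∃ m, e k n (res (join R B) m) :=
      Sig.of (e k) hk fun _ _ => Iff.rfl
    have hall := Sig.compact ((hP.comp (f := fun _ : ℕ => ()) (Primrec.const ())).or hS)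
    have : ∃ n, ¬ (n ∈ V ↔ ∀ R, P R ∨ ∃ m, e k n (res (join R B) m)) := by
      by_contra hcon
      push Not at hcon
      exact hB (hall.congr fun n _ => hcon n)
    obtain ⟨n, hn⟩ := this
    by_cases hnV : n ∈ V
    · have : ∃ R, ¬ (P R ∨ ∃ m, e k n (res (join R B) m)) := by
        by_contra hcon; push Not at hcon
        exact hn ⟨fun _ R => (by have := hcon R; tauto), fun _ => hnV⟩
      refine ⟨⟨fun R => P R ∨ ∃ m, e k n (res (join R B) m),
        hP.or (hS.comp (Primrec.const n)), this⟩, fun R h => Or.inl h, ?_⟩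
      intro R hR _ h
      exact hR (Or.inr ((h n).1 hnV))
    · refine ⟨⟨P, hP, hne⟩, fun _ h => h, fun R hR _ h => ?_⟩
      have h3 : ∀ R, P R ∨ ∃ m, e k n (res (join R B) m) := by
        by_contra hcon
        exact hn ⟨fun h => absurd h hnV, fun h => absurd h hcon⟩
      exact hnV ((h n).2 ((h3 R).resolve_left hR))) ⟨P, hP, hne⟩
  have hmono : ∀ k l, k ≤ l → ∀ R, (s k).1 R → (s l).1 R := by
    intro k l hkl
    induction hkl with
    | refl => exact fun _ h => h
    | step _ ih => exact fun R h => (hs _).1 R (ih R h)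
  have hR : ∃ R, ∀ k, ¬ (s k).1 R := by
    by_contra hcon
    push Not at hcon
    obtain ⟨k, hk⟩ := (isCompact_univ (X := ℕ → Bool)).elim_directed_cover
      (fun k => {b : ℕ → Bool | (s k).1 (bset b)})
      (fun k => by
        obtain ⟨D, h1, h2, h3⟩ := (s k).2.1
        have : {b : ℕ → Bool | (s k).1 (bset b)} =
            ⋃ m, {b : ℕ → Bool | D () (res (join (bset b) B) m)} := by
          ext b
          simp only [Set.mem_ofPred_eq, Set.mem_iUnion]
          exact h3 () (bset b)
        rw [this]
        exact isOpen_iUnion fun m => isOpen_res B _ _)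
      (fun b _ => Set.mem_iUnion.2 (hcon (bset b)))
      (Monotone.directed_le fun k l hkl b hb => hmono k l hkl _ hb)
    obtain ⟨R, hR⟩ := (s k).2.2
    obtain ⟨b, rfl⟩ := bset_surj R
    exact hR (hk (Set.mem_univ b))
  obtain ⟨R, hR⟩ := hR
  refine ⟨R, ?_, ?_⟩
  · have := hR 0
    rwa [hs0] at this
  · rintro ⟨D, h1, -, h3⟩
    obtain ⟨k, rfl⟩ := he D h1
    exact (hs k).2 R (hR (k + 1)) h1 fun n => h3 n ()

theorem question {V B : Set ℕ} (hB : Avoid V B) {P : ℕ → Set ℕ → Prop}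
    (hP : Sig (fun R => join R B) P) :
    (∃ n, n ∉ V ∧ ∀ R, P n R) ∨ (∃ n ∈ V, ∃ R, ¬ P n R ∧ Avoid V (join R B)) := by
  by_contra hcon
  push Not at hcon
  obtain ⟨h1, h2⟩ := hcon
  refine hB (hP.compact.congr fun n _ => ⟨fun hn => ?_, fun h => ?_⟩)
  · by_contra h
    push Not at h
    obtain ⟨R, hR, hA⟩ := basis hB (hP.comp (f := fun _ : Unit => n) (Primrec.const n)) h
    exact h2 n hn R hR hA
  · by_contra hn
    obtain ⟨R, hR⟩ := h1 n hn
    exact hR (h R)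



theorem mem_prec {f g : ℕ →. ℕ} {a n v : ℕ} :
    v ∈ (Nat.rec (motive := fun _ => Part ℕ) (f a)
      (fun y IH => IH >>= fun i => g (Nat.pair a (Nat.pair y i))) n) ↔
    ∃ L : List ℕ, L.getD 0 0 ∈ f a ∧
      (∀ y < n, L.getD (y + 1) 0 ∈ g (Nat.pair a (Nat.pair y (L.getD y 0)))) ∧
      L.getD n 0 = v := by
  induction n generalizing v with
  | zero =>
    constructor
    · intro h; exact ⟨[v], by simpa using h, by simp, by simp⟩
    · rintro ⟨L, h1, -, rfl⟩; exact h1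
  | succ n ih =>
    change v ∈ Part.bind _ _ ↔ _
    rw [Part.mem_bind_iff]
    constructor
    · rintro ⟨i, hi, hv⟩
      obtain ⟨L, h1, h2, h3⟩ := ih.1 hi
      refine ⟨(List.range (n + 1)).map (fun j => L.getD j 0) ++ [v], ?_, ?_, ?_⟩
      · simpa [List.getD, List.getElem?_append] using h1
      · intro y hy
        rcases Nat.lt_succ_iff_lt_or_eq.1 hy with h | rfl
        · have := h2 y h
          have e1 : y < n + 1 := by omega
          simpa [List.getD, List.getElem?_append, h, e1] using this
        · subst h3
          simpa [List.getD, List.getElem?_append] using hv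
      · simp [List.getD, List.getElem?_append]
    · rintro ⟨L, h1, h2, rfl⟩
      refine ⟨L.getD n 0, ih.2 ⟨L, h1, fun y hy => h2 y (by omega), rfl⟩, h2 n (by omega)⟩

theorem sig_of_rec {B : Set ℕ} {f : ℕ →. ℕ} (h : RecursiveIn (chi B) f) :
    Sig (fun _ : Unit => B) fun (p : ℕ × ℕ) _ => p.2 ∈ f p.1 := by
  induction h with
  | zero =>
    refine (Sig.prim (p := fun p : ℕ × ℕ => p.2 = 0)
      (Primrec.eq.comp Primrec.snd (Primrec.const 0))).congr fun p _ => ?_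
    exact Part.mem_some_iff
  | succ =>
    refine (Sig.prim (p := fun p : ℕ × ℕ => p.2 = p.1.succ)
      (Primrec.eq.comp Primrec.snd (Primrec.succ.comp Primrec.fst))).congr fun p _ => ?_
    exact Part.mem_some_iff
  | left =>
    refine (Sig.prim (p := fun p : ℕ × ℕ => p.2 = p.1.unpair.1)
      (Primrec.eq.comp Primrec.snd
        (Primrec.fst.comp (Primrec.unpair.comp Primrec.fst)))).congr fun p _ => ?_
    exact Part.mem_some_iff
  | right =>
    refine (Sig.prim (p := fun p : ℕ × ℕ => p.2 = p.1.unpair.2)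
      (Primrec.eq.comp Primrec.snd
        (Primrec.snd.comp (Primrec.unpair.comp Primrec.fst)))).congr fun p _ => ?_
    exact Part.mem_some_iff
  | oracle =>
    refine (((Sig.mem Primrec.fst).and (Sig.prim (p := fun p : ℕ × ℕ => p.2 = 1)
      (Primrec.eq.comp Primrec.snd (Primrec.const 1)))).or
      ((Sig.not_mem Primrec.fst).and (Sig.prim (p := fun p : ℕ × ℕ => p.2 = 0)
      (Primrec.eq.comp Primrec.snd (Primrec.const 0))))).congr fun p _ => ?_
    refine Part.mem_some_iff.trans ?_
    by_cases hp : p.1 ∈ B <;> simp [chi, hp]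
  | @pair f g _ _ ihf ihg =>
    have hu : Primrec fun p : ℕ × ℕ => p.2.unpair := Primrec.unpair.comp Primrec.snd
    refine ((ihf.comp (Primrec.fst.pair (Primrec.fst.comp hu))).and
      (ihg.comp (Primrec.fst.pair (Primrec.snd.comp hu)))).congr fun p _ => ?_
    simp only [Seq.seq, Functor.map]
    simp only [Part.mem_bind_iff, Part.mem_map_iff]
    constructor
    · rintro ⟨_, ⟨a, ha, rfl⟩, b, hb, h⟩
      rw [← h]; simpa using ⟨ha, hb⟩
    · rintro ⟨h1, h2⟩
      exact ⟨_, ⟨_, h1, rfl⟩, _, h2, by simp⟩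
  | @comp f g _ _ ihf ihg =>
    refine (Sig.ex (Q := fun (p : ℕ × ℕ) b (_ : Unit) => b ∈ g p.1 ∧ p.2 ∈ f b)
      ((ihg.comp ((Primrec.fst.comp Primrec.fst).pair Primrec.snd)).and
      (ihf.comp (Primrec.snd.pair (Primrec.snd.comp Primrec.fst))))).congr fun p _ => ?_
    exact Part.mem_bind_iff
  | @prec f g _ _ ihf ihg =>
    have hgd : Primrec₂ fun (L : List ℕ) (i : ℕ) => L.getD i 0 := Primrec.list_getD 0
    have hu : Primrec fun p : (ℕ × ℕ) × List ℕ => p.1.1.unpair :=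
      Primrec.unpair.comp (Primrec.fst.comp Primrec.fst)
    refine (Sig.ex (Q := fun (p : ℕ × ℕ) (L : List ℕ) (_ : Unit) =>
      L.getD 0 0 ∈ f p.1.unpair.1 ∧
      (∀ y < p.1.unpair.2, L.getD (y + 1) 0 ∈
        g (Nat.pair p.1.unpair.1 (Nat.pair y (L.getD y 0)))) ∧
      L.getD p.1.unpair.2 0 = p.2) ?_).congr fun p _ => mem_prec
    refine (ihf.comp ((Primrec.fst.comp hu).pair
      (hgd.comp Primrec.snd (Primrec.const 0)))).and (Sig.and ?_ ?_)
    · refine Sig.all_lt (Q := fun (p : (ℕ × ℕ) × List ℕ) y (_ : Unit) => p.2.getD (y + 1) 0 ∈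
        g (Nat.pair p.1.1.unpair.1 (Nat.pair y (p.2.getD y 0)))) ?_ (Primrec.snd.comp hu)
      exact ihg.comp (f := fun q : ((ℕ × ℕ) × List ℕ) × ℕ =>
        (Nat.pair q.1.1.1.unpair.1 (Nat.pair q.2 (q.1.2.getD q.2 0)), q.1.2.getD (q.2 + 1) 0))
        ((Primrec₂.natPair.comp (Primrec.fst.comp (hu.comp Primrec.fst))
          (Primrec₂.natPair.comp Primrec.snd (hgd.comp (Primrec.snd.comp Primrec.fst)
            Primrec.snd))).pair
          (hgd.comp (Primrec.snd.comp Primrec.fst) (Primrec.succ.comp Primrec.snd)))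
    · exact Sig.prim (Primrec.eq.comp (hgd.comp Primrec.snd (Primrec.snd.comp hu))
        (Primrec.snd.comp Primrec.fst))
  | @rfind f _ ih =>
    refine ((ih.comp (f := fun p : ℕ × ℕ => (Nat.pair p.1 p.2, 0))
      ((Primrec₂.natPair.comp Primrec.fst Primrec.snd).pair (Primrec.const 0))).and
      (Sig.all_lt (Q := fun (p : ℕ × ℕ) m (_ : Unit) =>
        ∃ w, w ≠ 0 ∧ w ∈ f (Nat.pair p.1 m)) (Sig.ex (Q := fun (p : (ℕ × ℕ) × ℕ) w (_ : Unit) =>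
        w ≠ 0 ∧ w ∈ f (Nat.pair p.1.1 p.2)) ?_) Primrec.snd)).congr fun p _ => ?_
    · refine (Sig.prim (Primrec.eq.comp Primrec.snd (Primrec.const 0)).not).and
        (ih.comp (f := fun q : ((ℕ × ℕ) × ℕ) × ℕ => (Nat.pair q.1.1.1 q.1.2, q.2)) ?_)
      exact (Primrec₂.natPair.comp (Primrec.fst.comp (Primrec.fst.comp Primrec.fst))
        (Primrec.snd.comp Primrec.fst)).pair Primrec.snd
    · refine Nat.mem_rfind.trans ?_
      simp only [Functor.map, Part.mem_map_iff]
      constructor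
      · rintro ⟨⟨a, ha, h0⟩, h⟩
        have h0 : a = 0 := by simpa using h0
        subst h0
        refine ⟨ha, fun m hm => ?_⟩
        obtain ⟨w, hw, h0⟩ := h hm
        exact ⟨w, by simpa using h0, hw⟩
      · rintro ⟨h1, h2⟩
        refine ⟨⟨0, h1, by simp⟩, fun hm => ?_⟩
        obtain ⟨w, hw, h0⟩ := h2 _ hm
        exact ⟨w, h0, by simpa using hw⟩

theorem red_of_turing {W B : Set ℕ} (h : TuringLE W B) : Red W B := by
  have := sig_of_rec h
  have e : ∀ n v, v ∈ (↑(chi W) : ℕ →. ℕ) n ↔ v = chi W n := fun n v => Part.mem_some_iff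
  constructor
  · refine (this.comp (f := fun n => (n, 1)) (Primrec.id.pair (Primrec.const 1))).congr
      fun n _ => ?_
    refine Iff.trans ?_ (e n 1).symm
    by_cases h : n ∈ W <;> simp [chi, h]
  · refine (this.comp (f := fun n => (n, 0)) (Primrec.id.pair (Primrec.const 0))).congr
      fun n _ => ?_
    refine Iff.trans ?_ (e n 0).symm
    by_cases h : n ∈ W <;> simp [chi, h]

theorem not_avoid_of_turing {W B : Set ℕ} (h : TuringLE W B) : ¬ Avoid (join W Wᶜ) B := by
  unfold Avoid
  rw [not_not]
  exact ((red_of_turing h).join (red_of_turing h).compl).1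

theorem RecursiveIn.of_eq {O f g : ℕ →. ℕ} (h : RecursiveIn O f) (e : ∀ n, f n = g n) :
    RecursiveIn O g := (funext e : f = g) ▸ h

theorem RecursiveIn.tcomp {O : ℕ →. ℕ} {f g : ℕ → ℕ} (hf : RecursiveIn O f)
    (hg : RecursiveIn O g) : RecursiveIn O (fun n => f (g n) : ℕ → ℕ) :=
  (RecursiveIn.comp hf hg).of_eq fun n => Part.bind_some _ _

theorem RecursiveIn.tpair {O : ℕ →. ℕ} {f g : ℕ → ℕ} (hf : RecursiveIn O f)
    (hg : RecursiveIn O g) : RecursiveIn O (fun n => Nat.pair (f n) (g n) : ℕ → ℕ) :=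
  (RecursiveIn.pair hf hg).of_eq fun n => by simp [Seq.seq]

theorem RecursiveIn.tprec {O : ℕ →. ℕ} {f g : ℕ → ℕ} (hf : RecursiveIn O f)
    (hg : RecursiveIn O g) : RecursiveIn O (Nat.unpaired fun a n =>
        n.rec (f a) fun y IH => g (Nat.pair a (Nat.pair y IH)) : ℕ → ℕ) :=
  (RecursiveIn.prec hf hg).of_eq fun n => by
    simp only [Nat.unpaired, PFun.coe_val]
    induction n.unpair.2 with
    | zero => rfl
    | succ m ih => simp only [ih]; exact Part.bind_some _ _

theorem RecursiveIn.of_primrec {O : ℕ →. ℕ} {f : ℕ → ℕ} (hf : Nat.Primrec f) :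
    RecursiveIn O f := by
  induction hf with
  | zero => exact RecursiveIn.zero
  | succ => exact RecursiveIn.succ
  | left => exact RecursiveIn.left
  | right => exact RecursiveIn.right
  | pair _ _ h1 h2 => exact h1.tpair h2
  | comp _ _ h1 h2 => exact h1.tcomp h2
  | prec _ _ h1 h2 => exact h1.tprec h2

open Classical in
theorem res_succ (A : Set ℕ) (n : ℕ) : res A (n + 1) = res A n ++ [decide (n ∈ A)] := by
  unfold res
  rw [List.range_succ, List.map_append]
  rfl

theorem RecursiveIn.iter {O : ℕ →. ℕ} {st h : ℕ → ℕ} (hst : RecursiveIn O st)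
    (h1 : ∀ n, h (n + 1) = st (Nat.pair n (h n))) : RecursiveIn O h := by
  have h0 : RecursiveIn O (fun _ => h 0 : ℕ → ℕ) :=
    RecursiveIn.of_primrec (Nat.Primrec.const _)
  have hr : RecursiveIn O (fun n : ℕ => n.unpair.2) := RecursiveIn.right
  have := (h0.tprec (hst.tcomp hr)).tcomp (RecursiveIn.of_primrec
    (f := fun n => Nat.pair 0 n) ((Nat.Primrec.const 0).pair Nat.Primrec.id))
  refine this.of_eq fun n => ?_
  simp only [PFun.coe_val]
  congr 1
  simp only [Nat.unpaired, Nat.unpair_pair]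
  induction n with
  | zero => rfl
  | succ n ih => rw [h1, ← ih]

theorem rec_res (Z : Set ℕ) :
    RecursiveIn (chi Z) (fun m => Encodable.encode (res Z m) : ℕ → ℕ) := by
  classical
  let ap : ℕ → ℕ := fun n =>
    Encodable.encode (((Encodable.decode (α := List Bool) n.unpair.1).getD []) ++
      [decide (n.unpair.2 = 1)])
  have hap : Primrec ap := by
    refine Primrec.encode.comp (Primrec.list_append.comp
      (Primrec.option_getD.comp (Primrec.decode.comp (Primrec.fst.comp Primrec.unpair))
        (Primrec.const [])) ?_)
    refine Primrec.list_cons.comp ?_ (Primrec.const [])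
    exact (Primrec.eq.comp (Primrec.snd.comp Primrec.unpair) (Primrec.const 1)).decide
  have hap' : Nat.Primrec ap := Primrec.nat_iff.1 hap
  have hl : RecursiveIn (chi Z) (fun n : ℕ => n.unpair.1) := RecursiveIn.left
  have hr : RecursiveIn (chi Z) (fun n : ℕ => n.unpair.2) := RecursiveIn.right
  have hstep := (RecursiveIn.of_primrec (O := chi Z) hap').tcomp
    (hr.tpair ((RecursiveIn.oracle (O := chi Z)).tcomp hl))
  refine hstep.iter fun n => ?_
  simp only [ap, Nat.unpair_pair, Encodable.encodek, Option.getD_some, res_succ]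
  congr 3
  by_cases h : n ∈ Z <;> simp [chi, h]

theorem turing_of_sig {W Z : Set ℕ}
    (h : Sig (fun _ : Unit => Z) fun n _ => n ∈ join W Wᶜ) : TuringLE W Z := by
  classical
  obtain ⟨D, h1, -, h3⟩ := h
  have e0 : ∀ n, n ∈ W ↔ ∃ m, D (2 * n) (res Z m) := fun n =>
    mem_join_left.symm.trans (h3 _ ())
  have e1 : ∀ n, n ∉ W ↔ ∃ m, D (2 * n + 1) (res Z m) := fun n =>
    (mem_join_right (B := Wᶜ)).symm.trans (h3 _ ())
  let de : ℕ → List Bool := fun n => (Encodable.decode (α := List Bool) n.unpair.2).getD []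
  have hde : Primrec de := Primrec.option_getD.comp
    (Primrec.decode.comp (Primrec.snd.comp Primrec.unpair)) (Primrec.const [])
  have hl : Primrec fun n : ℕ => n.unpair.1 := Primrec.fst.comp Primrec.unpair
  have hD0 : PrimrecPred fun n : ℕ => D (2 * n.unpair.1) (de n) :=
    PrimrecRel.comp h1 (Primrec.nat_double.comp hl) hde
  have hD1 : PrimrecPred fun n : ℕ => D (2 * n.unpair.1 + 1) (de n) :=
    PrimrecRel.comp h1 (Primrec.nat_double_succ.comp hl) hde
  have hE := Primrec.nat_iff.1
    (Primrec.ite (hD0.or hD1) (Primrec.const 0) (Primrec.const 1))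
  have hO := Primrec.nat_iff.1 (Primrec.ite hD0 (Primrec.const 1) (Primrec.const 0))
  have hl : RecursiveIn (chi Z) (fun n : ℕ => n.unpair.1) := RecursiveIn.left
  have hr : RecursiveIn (chi Z) (fun n : ℕ => n.unpair.2) := RecursiveIn.right
  have hid : RecursiveIn (chi Z) (fun n : ℕ => n) := RecursiveIn.of_primrec Nat.Primrec.id
  have hE' := (RecursiveIn.of_primrec (O := chi Z) hE).tcomp
    (hl.tpair ((rec_res Z).tcomp hr))
  have hO' := (RecursiveIn.of_primrec (O := chi Z) hO).tcomp
    (hl.tpair ((rec_res Z).tcomp hr))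
  have hex : ∀ n, ∃ m, D (2 * n) (res Z m) ∨ D (2 * n + 1) (res Z m) := by
    intro n
    by_cases h : n ∈ W
    · obtain ⟨m, hm⟩ := (e0 n).1 h; exact ⟨m, Or.inl hm⟩
    · obtain ⟨m, hm⟩ := (e1 n).1 h; exact ⟨m, Or.inr hm⟩
  have hμ : RecursiveIn (chi Z) (fun n => Nat.find (hex n) : ℕ → ℕ) := by
    refine (RecursiveIn.rfind hE').of_eq fun n => ?_
    refine Part.eq_some_iff.2 ?_
    refine Nat.mem_rfind.2 ?_
    have key : ∀ m b, b ∈ ((fun m => decide (m = 0)) <$>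
        (Part.some (if D (2 * n) (res Z m) ∨ D (2 * n + 1) (res Z m) then 0 else 1))) ↔
        b = decide (D (2 * n) (res Z m) ∨ D (2 * n + 1) (res Z m)) := by
      intro m b
      by_cases h : D (2 * n) (res Z m) ∨ D (2 * n + 1) (res Z m) <;> simp [h]
    have key' : ∀ m b, b ∈ ((fun m => decide (m = 0)) <$>
        ((fun x : ℕ => if D (2 * (Nat.pair x.unpair.1
          (Encodable.encode (res Z x.unpair.2))).unpair.1) (de (Nat.pair x.unpair.1
          (Encodable.encode (res Z x.unpair.2)))) ∨ D (2 * (Nat.pair x.unpair.1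
          (Encodable.encode (res Z x.unpair.2))).unpair.1 + 1) (de (Nat.pair x.unpair.1
          (Encodable.encode (res Z x.unpair.2)))) then 0 else 1 : ℕ → ℕ) : ℕ →. ℕ)
            (Nat.pair n m)) ↔
        b = decide (D (2 * n) (res Z m) ∨ D (2 * n + 1) (res Z m)) := by
      intro m b
      rw [← key m b]
      simp [de]
    refine ⟨(key' _ _).2 ?_, fun {m} hm => (key' _ _).2 ?_⟩
    · simpa using Nat.find_spec (hex n)
    · have := Nat.find_min (hex n) hm
      simpa using this
  refine (hO'.tcomp (hid.tpair hμ)).of_eq fun n => ?_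
  simp only [PFun.coe_val]
  congr 1
  simp only [Nat.unpair_pair, de, Encodable.encodek, Option.getD_some]
  have hs := Nat.find_spec (hex n)
  by_cases h : n ∈ W
  · have : D (2 * n) (res Z (Nat.find (hex n))) := by
      refine hs.resolve_right fun h' => (e1 n).2 ⟨_, h'⟩ h
    simp [chi, h, this]
  · have : ¬ D (2 * n) (res Z (Nat.find (hex n))) := fun h' => h ((e0 n).2 ⟨_, h'⟩)
    simp [chi, h, this]



/-- finite set coded by a list -/
def ls (l : List ℕ) : Set ℕ := {x | x ∈ l}

theorem mem_ls {l : List ℕ} {x : ℕ} : x ∈ ls l ↔ x ∈ l := Iff.rfl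

theorem ls_append (l l' : List ℕ) : ls (l ++ l') = ls l ∪ ls l' := by ext; simp [ls]

theorem ls_nil : ls [] = ∅ := by ext; simp [ls]

theorem ls_cons (x : ℕ) (l : List ℕ) : ls (x :: l) = insert x (ls l) := by ext; simp [ls]

theorem ls_surj {F : Set ℕ} (h : F.Finite) : ∃ l, ls l = F :=
  ⟨h.toFinset.toList, by ext; simp [ls]⟩

theorem ls_finite (l : List ℕ) : (ls l).Finite := List.finite_toSet l

theorem ls_bdd (l : List ℕ) : ∃ b, ∀ x ∈ ls l, x ≤ b := by
  obtain ⟨b, hb⟩ := (ls_finite l).bddAbove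
  exact ⟨b, fun x hx => hb hx⟩

/-- the class of admissible reservoirs -/
def Rsv (V B Y0 Y : Set ℕ) : Prop := Y ⊆ Y0 ∧ Y.Infinite ∧ Avoid V (join Y B)

theorem Rsv.sub {V B Y0 Y Y' : Set ℕ} (h : Rsv V B Y0 Y) (h' : Rsv V B Y Y') : Rsv V B Y0 Y' :=
  ⟨h'.1.trans h.1, h'.2⟩

theorem avoid_trunc {V B Y : Set ℕ} (h : Avoid V (join Y B)) (k : ℕ) :
    Avoid V (join (Y ∩ {x | k < x}) B) :=
  h.mono (Red.join (Red.inter (red_join_left _ _) (red_gt _ _)) (red_join_right _ _))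

theorem infinite_trunc {Y : Set ℕ} (h : Y.Infinite) (k : ℕ) : (Y ∩ {x | k < x}).Infinite := by
  intro hf
  apply h
  refine (hf.union (Set.finite_Iic k)).subset fun x hx => ?_
  by_cases hk : k < x
  · exact Or.inl ⟨hx, hk⟩
  · exact Or.inr (not_lt.1 hk)

theorem Rsv.trunc {V B Y0 Y : Set ℕ} (h : Rsv V B Y0 Y) (k : ℕ) :
    Rsv V B Y0 (Y ∩ {x | k < x}) :=
  ⟨Set.inter_subset_left.trans h.1, infinite_trunc h.2.1 k, avoid_trunc h.2.2 k⟩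

theorem res_join_congr {A A' B : Set ℕ} {m : ℕ} (h : ∀ i < m, (i ∈ A ↔ i ∈ A')) :
    res (join A B) m = res (join A' B) m := by
  apply res_congr
  intro i hi
  rw [mem_join, mem_join, h (i / 2) (by omega)]

def Hyp2 (V B Y0 : Set ℕ) (T : Set ℕ → Prop) : Prop :=
  ∀ (E : List ℕ) (Y : Set ℕ) (D : ℕ → List Bool → Prop), ls E ⊆ Y0 → T (ls E) → Rsv V B Y0 Y →
    PrimrecRel D →
    ∃ n, (n ∉ V ∧ ∃ F : List ℕ, ls F ⊆ Y ∧ T (ls (E ++ F)) ∧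
        ∃ m, D n (res (join (ls (E ++ F)) B) m)) ∨
      (n ∈ V ∧ ∃ Y', Rsv V B Y Y' ∧ ∀ F : List ℕ, ls F ⊆ Y' → T (ls (E ++ F)) →
        ∀ m, ¬ D n (res (join (ls (E ++ F)) B) m))

theorem gen {V B Y0 : Set ℕ} (hY0 : Y0.Infinite) (hav : Avoid V (join Y0 B))
    (T : Set ℕ → Prop) (hT0 : T ∅) (hTm : ∀ A A', A' ⊆ A → T A → T A')
    (K : ℕ → Set ℕ → Prop)
    (hyp1 : ∀ (E : List ℕ) (Y : Set ℕ), ls E ⊆ Y0 → T (ls E) → Rsv V B Y0 Y →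
      ∃ z ∈ Y, T (ls (E ++ [z])))
    (hyp2 : Hyp2 V B Y0 T)
    (hyp3 : ∀ i Y, Rsv V B Y0 Y → ∃ Y', Rsv V B Y Y' ∧ K i Y') :
    ∃ G, Rsv V B Y0 G ∧ (∀ L, ls L ⊆ G → T (ls L)) ∧
      ∀ i, ∃ Y' b, K i Y' ∧ ∀ x ∈ G, b < x → x ∈ Y' := by
  obtain ⟨e, he⟩ := exists_enum
  let C := {c : List ℕ × Set ℕ // ls c.1 ⊆ Y0 ∧ T (ls c.1) ∧ Rsv V B Y0 c.2}
  let le : C → C → Prop := fun c' c => c'.1.2 ⊆ c.1.2 ∧ ∃ H, c'.1.1 = c.1.1 ++ H ∧ ls H ⊆ c.1.2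
  let Rq : ℕ → ℕ → C → Prop := fun r k c =>
    if r = 0 then (∃ z ∈ c.1.1, k < z) ∧ ∀ y ∈ c.1.2, k < y
    else if r = 1 then PrimrecRel (e k) → ∃ n,
      (n ∉ V ∧ ∃ m, e k n (res (join (ls c.1.1) B) m) ∧ ∀ y ∈ c.1.2, m ≤ y) ∨
      (n ∈ V ∧ ∀ H, ls H ⊆ c.1.2 → T (ls (c.1.1 ++ H)) →
        ∀ m, ¬ e k n (res (join (ls (c.1.1 ++ H)) B) m))
    else K k c.1.2
  have hext : ∀ r k c, ∃ c', le c' c ∧ Rq r k c' := by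
    rintro r k ⟨⟨F, Y⟩, h1, h2, h3⟩
    by_cases hr0 : r = 0
    · obtain ⟨z, ⟨hz, hkz⟩, hT⟩ := hyp1 F _ h1 h2 (h3.trunc k)
      refine ⟨⟨(F ++ [z], Y ∩ {x | k < x}), ?_, hT, h3.trunc k⟩,
        ⟨Set.inter_subset_left, [z], rfl, ?_⟩, ?_⟩
      · rintro x hx
        rcases List.mem_append.1 hx with hx | hx
        · exact h1 hx
        · rw [List.mem_singleton.1 hx]; exact h3.1 hz
      · intro x hx; rw [List.mem_singleton.1 hx]; exact hz
      · simp only [Rq, hr0, if_true]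
        exact ⟨⟨z, by simp, hkz⟩, fun y hy => hy.2⟩
    by_cases hr1 : r = 1
    · by_cases hk : PrimrecRel (e k)
      swap
      · refine ⟨⟨(F, Y), h1, h2, h3⟩, ⟨subset_rfl, [], by simp, by simp [ls]⟩, ?_⟩
        simp only [Rq, hr1, if_true]
        simp [hk]
      obtain ⟨n, ⟨hn, H, hH, hT, m, hm⟩ | ⟨hn, Y', hY', hno⟩⟩ := hyp2 F Y (e k) h1 h2 h3 hk
      · refine ⟨⟨(F ++ H, Y ∩ {x | m < x}), ?_, hT, h3.trunc m⟩,
          ⟨Set.inter_subset_left, H, rfl, hH⟩, ?_⟩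
        · rw [ls_append]; exact Set.union_subset h1 (hH.trans h3.1)
        · simp only [Rq, hr1, if_true]
          exact fun _ => ⟨n, Or.inl ⟨hn, m, hm, fun y hy => hy.2.le⟩⟩
      · refine ⟨⟨(F, Y'), h1, h2, h3.sub hY'⟩, ⟨hY'.1, [], by simp, by simp [ls]⟩, ?_⟩
        simp only [Rq, hr1, if_true]
        exact fun _ => ⟨n, Or.inr ⟨hn, hno⟩⟩
    · obtain ⟨Y', hY', hK⟩ := hyp3 k Y h3
      refine ⟨⟨(F, Y'), h1, h2, h3.sub hY'⟩, ⟨hY'.1, [], by simp, by simp [ls]⟩, ?_⟩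
      simpa only [Rq, hr0, hr1, if_false] using hK
  obtain ⟨s, hs0, hs⟩ := generic_seq le (fun k c => Rq (k % 3) (k / 3) c)
    (fun k c => hext _ _ c) ⟨([], Y0), by simp [ls], by rw [ls_nil]; exact hT0,
      subset_rfl, hY0, hav⟩
  have hle : ∀ k l, k ≤ l → le (s l) (s k) := by
    intro k l hkl
    induction hkl with
    | refl => exact ⟨subset_rfl, [], by simp, by simp [ls]⟩
    | @step l _ ih =>
      obtain ⟨a1, H, a2, a3⟩ := ih
      obtain ⟨b1, H', b2, b3⟩ := (hs l).1
      refine ⟨b1.trans a1, H ++ H', ?_, ?_⟩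
      · rw [b2, a2, List.append_assoc]
      · rw [ls_append]; exact Set.union_subset a3 (b3.trans a1)
  have hreq : ∀ r k, r < 3 → ∃ j, Rq r k (s j) := fun r k hr => by
    refine ⟨3 * k + r + 1, ?_⟩
    have := (hs (3 * k + r)).2
    rwa [show (3 * k + r) % 3 = r by omega, show (3 * k + r) / 3 = k by omega] at this
  have hFm : ∀ k l, k ≤ l → ls (s k).1.1 ⊆ ls (s l).1.1 := by
    intro k l hkl
    obtain ⟨_, H, a2, _⟩ := hle k l hkl
    rw [a2, ls_append]; exact Set.subset_union_left
  let G : Set ℕ := ⋃ k, ls (s k).1.1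
  have hGs : ∀ k, G ⊆ ls (s k).1.1 ∪ (s k).1.2 := by
    intro k x hx
    obtain ⟨l, hl⟩ := Set.mem_iUnion.1 hx
    obtain ⟨_, H, a2, a3⟩ := hle k (max k l) (le_max_left _ _)
    have := hFm l (max k l) (le_max_right _ _) hl
    rw [a2, ls_append] at this
    exact this.imp id fun h => a3 h
  have hsG : ∀ k, ls (s k).1.1 ⊆ G := fun k => Set.subset_iUnion (fun k => ls (s k).1.1) k
  have hGY : G ⊆ Y0 := Set.iUnion_subset fun k => (s k).2.1
  have hGi : G.Infinite := by
    rw [Set.infinite_iff_exists_gt]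
    intro k
    obtain ⟨j, hj⟩ := hreq 0 k (by omega)
    simp only [Rq, if_true] at hj
    obtain ⟨⟨z, hz, hk⟩, _⟩ := hj
    exact ⟨z, hsG j hz, hk⟩
  have hGT : ∀ L, ls L ⊆ G → T (ls L) := by
    intro L hL
    have : ∃ k, ls L ⊆ ls (s k).1.1 := by
      induction L with
      | nil => exact ⟨0, by simp [ls]⟩
      | cons x L ih =>
        obtain ⟨k, hk⟩ := ih fun y hy => hL (List.mem_cons_of_mem _ hy)
        obtain ⟨l, hl⟩ := Set.mem_iUnion.1 (hL (List.mem_cons_self : x ∈ x :: L))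
        refine ⟨max k l, ?_⟩
        rw [ls_cons]
        exact Set.insert_subset (hFm _ _ (le_max_right _ _) hl)
          (hk.trans (hFm _ _ (le_max_left _ _)))
    obtain ⟨k, hk⟩ := this
    exact hTm _ _ hk (s k).2.2.1
  refine ⟨G, ⟨hGY, hGi, ?_⟩, hGT, ?_⟩
  · rintro ⟨D, hD1, -, hD3⟩
    obtain ⟨k, rfl⟩ := he D hD1
    obtain ⟨j, hj⟩ := hreq 1 k (by omega)
    simp only [Rq, if_true, one_ne_zero, if_false] at hj
    obtain ⟨n, ⟨hn, m, hm, hY⟩ | ⟨hn, hno⟩⟩ := hj hD1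
    · refine hn ((hD3 n ()).2 ⟨m, ?_⟩)
      rwa [res_join_congr (A' := ls (s j).1.1)]
      intro i hi
      refine ⟨fun h => (hGs j h).resolve_right fun h' => ?_, fun h => hsG j h⟩
      have := hY i h'; omega
    · obtain ⟨m, hm⟩ := (hD3 n ()).1 hn
      obtain ⟨l, hl⟩ := hreq 0 m (by omega)
      simp only [Rq, if_true] at hl
      obtain ⟨_, hY⟩ := hl
      obtain ⟨_, H, a2, a3⟩ := hle j (max j l) (le_max_left _ _)
      have hb := (hle l (max j l) (le_max_right _ _)).1
      refine hno H a3 (a2 ▸ (s (max j l)).2.2.1) m ?_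
      rw [← a2]
      rwa [← res_join_congr (A := G)]
      intro i hi
      refine ⟨fun h => (hGs (max j l) h).resolve_right fun h' => ?_, fun h => hsG _ h⟩
      have := hY i (hb h'); omega
  · intro i
    obtain ⟨j, hj⟩ := hreq 2 i (by omega)
    have hj : K i (s j).1.2 := by simpa only [Rq, OfNat.ofNat_ne_zero, OfNat.ofNat_ne_one, if_false] using hj
    obtain ⟨b, hb⟩ := ls_bdd (s j).1.1
    refine ⟨(s j).1.2, b, hj, fun x hx hbx => (hGs j hx).resolve_left fun h => ?_⟩
    have := hb x h; omega



section
variable {Γ α : Type*} [Primcodable α] {q : Γ → Set ℕ}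

theorem sig_D {D : ℕ → List Bool → Prop} (hD : PrimrecRel D) {B : Γ → Set ℕ}
    (hB : Dec q fun (_ : α) γ => B γ) {f : α → ℕ} (hf : Primrec f) {l : α → List ℕ}
    (hl : Primrec l) :
    Sig q fun a γ => ∃ m, D (f a) (res (join (ls (l a)) (B γ)) m) := by
  have h0 : Sig (fun A : Set ℕ => A) fun (a : α) A => ∃ m, D (f a) (res A m) :=
    (Sig.of D hD fun _ _ => Iff.rfl : Sig (fun A : Set ℕ => A)
      fun n A => ∃ m, D n (res A m)).comp hf
  exact h0.subst' (fun a γ => join (ls (l a)) (B γ)) ((Dec.ofList hl).join hB)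

theorem sig_subset {T : α → Γ → Set ℕ} (hT : Dec q T) {l : α → List ℕ} (hl : Primrec l) :
    Sig q fun a γ => ls (l a) ⊆ T a γ :=
  (Sig.all (Q := fun a x γ => x ∈ T a γ) hT.1 hl).congr fun _ _ => Iff.rfl

end

theorem hyp2_of_sig {V B Y0 : Set ℕ} {T : Set ℕ → Prop}
    (hT : Sig (fun _ : Unit => B) fun (l : List ℕ) _ => T (ls l)) : Hyp2 V B Y0 T := by
  intro E Y D _ _ hY hD
  have hBd : ∀ {α : Type} [Primcodable α], Dec (fun R => join R (join Y B)) fun (_ : α) _ => B :=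
    fun {α} _ => Dec.right (A := fun _ => Y) (Dec.right (A := fun R => R) Dec.id)
  have hYd : ∀ {α : Type} [Primcodable α], Dec (fun R => join R (join Y B)) fun (_ : α) _ => Y :=
    fun {α} _ => Dec.left (B := fun _ => B) (Dec.right (A := fun R => R) Dec.id)
  have hEF : Primrec fun p : ℕ × List ℕ => E ++ p.2 :=
    Primrec.list_append.comp (Primrec.const E) Primrec.snd
  have hP : Sig (fun R => join R (join Y B)) fun (n : ℕ) _ => ∃ F : List ℕ, ls F ⊆ Y ∧
      T (ls (E ++ F)) ∧ ∃ m, D n (res (join (ls (E ++ F)) B) m) := by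
    refine Sig.ex (Q := fun n F _ => ls F ⊆ Y ∧
      T (ls (E ++ F)) ∧ ∃ m, D n (res (join (ls (E ++ F)) B) m)) ?_
    refine (sig_subset hYd Primrec.snd).and (Sig.and ?_ ?_)
    · exact (hT.comp hEF).subst' (fun _ _ => ()) hBd
    · exact sig_D hD hBd Primrec.fst hEF
  rcases question hY.2.2 hP with ⟨n, hn, h⟩ | ⟨n, hn, R, hR, _⟩
  · exact ⟨n, Or.inl ⟨hn, h ∅⟩⟩
  · exact ⟨n, Or.inr ⟨hn, Y, ⟨subset_rfl, hY.2⟩, fun F hF hT m hm => hR ⟨F, hF, hT, m, hm⟩⟩⟩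

theorem dj {V B Y : Set ℕ} (hY : Y.Infinite) (hav : Avoid V (join Y B)) (A : Set ℕ) :
    ∃ Y', Rsv V B Y Y' ∧ (Y' ⊆ A ∨ Y' ⊆ Aᶜ) := by
  by_contra hcon
  push Not at hcon
  have n1 : ¬ Hyp2 V B Y (· ⊆ A) := by
    intro h2
    obtain ⟨G, hG, hGA, -⟩ := gen hY hav (· ⊆ A) (by simp) (fun _ _ h h' => h.trans h')
      (fun _ _ => True) (fun E Y' _ hE hY' => by
        obtain ⟨z, hz, hz'⟩ := Set.not_subset.1 (hcon Y' hY').2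
        refine ⟨z, hz, ?_⟩
        rw [ls_append, ls_cons, ls_nil]
        exact Set.union_subset hE (by simpa using hz')) h2
      (fun _ Y' h => ⟨Y', ⟨subset_rfl, h.2⟩, trivial⟩)
    exact (hcon G hG).1 fun x hx => hGA [x] (by simpa [ls] using hx) (by simp [ls])
  unfold Hyp2 at n1
  push Not at n1
  obtain ⟨E0, Y0, D0, _, hE0, hY0, hD0, H0⟩ := n1
  have n2 : ¬ Hyp2 V B Y0 (· ⊆ Aᶜ) := by
    intro h2
    obtain ⟨G, hG, hGA, -⟩ := gen hY0.2.1 hY0.2.2 (· ⊆ Aᶜ) (by simp) (fun _ _ h h' => h.trans h')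
      (fun _ _ => True) (fun E Y' _ hE hY' => by
        obtain ⟨z, hz, hz'⟩ := Set.not_subset.1 (hcon Y' (hY0.sub hY')).1
        refine ⟨z, hz, ?_⟩
        rw [ls_append, ls_cons, ls_nil]
        exact Set.union_subset hE (by simpa using hz')) h2
      (fun _ Y' h => ⟨Y', ⟨subset_rfl, h.2⟩, trivial⟩)
    exact (hcon G (hY0.sub hG)).2 fun x hx => hGA [x] (by simpa [ls] using hx) (by simp [ls])
  unfold Hyp2 at n2
  push Not at n2
  obtain ⟨E1, Y1, D1, _, hE1, hY1, hD1, H1⟩ := n2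
  have hBd : ∀ {α : Type} [Primcodable α], Dec (fun R => join R (join Y1 B)) fun (_ : α) _ => B :=
    fun {α} _ => Dec.right (A := fun _ => Y1) (Dec.right (A := fun R => R) Dec.id)
  have hYd : ∀ {α : Type} [Primcodable α], Dec (fun R => join R (join Y1 B)) fun (_ : α) _ => Y1 :=
    fun {α} _ => Dec.left (B := fun _ => B) (Dec.right (A := fun R => R) Dec.id)
  have hRd : ∀ {α : Type} [Primcodable α],
      Dec (fun R => join R (join Y1 B)) fun (_ : α) R => R :=
    fun {α} _ => Dec.left (A := fun R => R) Dec.id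
  have hEF : ∀ E : List ℕ, Primrec fun p : ℕ × List ℕ => E ++ p.2 := fun E =>
    Primrec.list_append.comp (Primrec.const E) Primrec.snd
  have hP : Sig (fun R => join R (join Y1 B)) fun (n : ℕ) R =>
      (∃ F : List ℕ, ls F ⊆ Y1 ∩ R ∧ ∃ m, D0 n (res (join (ls (E0 ++ F)) B) m)) ∨
      (∃ F : List ℕ, ls F ⊆ Y1 ∩ Rᶜ ∧ ∃ m, D1 n (res (join (ls (E1 ++ F)) B) m)) := by
    refine Sig.or (Sig.ex (Q := fun n F R => ls F ⊆ Y1 ∩ R ∧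
      ∃ m, D0 n (res (join (ls (E0 ++ F)) B) m)) ?_) (Sig.ex (Q := fun n F R => ls F ⊆ Y1 ∩ Rᶜ ∧
      ∃ m, D1 n (res (join (ls (E1 ++ F)) B) m)) ?_)
    · exact (sig_subset (hYd.inter hRd) Primrec.snd).and (sig_D hD0 hBd Primrec.fst (hEF E0))
    · exact (sig_subset (hYd.inter hRd.compl) Primrec.snd).and
        (sig_D hD1 hBd Primrec.fst (hEF E1))
  rcases question hY1.2.2 hP with ⟨n, hn, h⟩ | ⟨n, hn, R, hR, hA⟩
  · rcases h A with ⟨F, hF, m, hm⟩ | ⟨F, hF, m, hm⟩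
    · refine (H0 n).1 hn F (fun x hx => hY1.1 (hF hx).1) ?_ m hm
      rw [ls_append]; exact Set.union_subset hE0 fun x hx => (hF hx).2
    · refine (H1 n).1 hn F (fun x hx => (hF hx).1) ?_ m hm
      rw [ls_append]; exact Set.union_subset hE1 fun x hx => (hF hx).2
  · push Not at hR
    have rR := red_join_left R (join Y1 B)
    have rY := (red_join_left Y1 B).trans (red_join_right R _)
    have rB := (red_join_right Y1 B).trans (red_join_right R _)
    by_cases hi : (Y1 ∩ R).Infinite
    · obtain ⟨F, hF, _, m, hm⟩ := (H0 n).2 hn (Y1 ∩ R)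
        ⟨Set.inter_subset_left.trans hY1.1, hi, hA.mono ((rY.inter rR).join rB)⟩
      exact hR.1 F hF m hm
    · have hi' : (Y1 ∩ Rᶜ).Infinite := by
        intro hf
        apply hY1.2.1
        have := (Set.not_infinite.1 hi).union hf
        rwa [← Set.inter_union_distrib_left, Set.union_compl_self, Set.inter_univ] at this
      obtain ⟨F, hF, _, m, hm⟩ := (H1 n).2 hn (Y1 ∩ Rᶜ)
        ⟨Set.inter_subset_left, hi', hA.mono ((rY.inter rR.compl).join rB)⟩
      exact hR.2 F hF m hm

/-- eventually in `C` -/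
def Ev (C : Set ℕ) (P : ℕ → Prop) : Prop := ∃ b, ∀ x ∈ C, b < x → P x

theorem Ev.mono {C C' : Set ℕ} {P P' : ℕ → Prop} (h : Ev C P) (hC : C' ⊆ C)
    (hP : ∀ x, P x → P' x) : Ev C' P' := by
  obtain ⟨b, hb⟩ := h
  exact ⟨b, fun x hx hbx => hP x (hb x (hC hx) hbx)⟩

theorem Ev.and {C : Set ℕ} {P P' : ℕ → Prop} (h : Ev C P) (h' : Ev C P') :
    Ev C fun x => P x ∧ P' x := by
  obtain ⟨b, hb⟩ := h
  obtain ⟨b', hb'⟩ := h'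
  exact ⟨max b b', fun x hx hbx => ⟨hb x hx (lt_of_le_of_lt (le_max_left _ _) hbx),
    hb' x hx (lt_of_le_of_lt (le_max_right _ _) hbx)⟩⟩

theorem Ev.exists {C : Set ℕ} {P : ℕ → Prop} (h : Ev C P) (hC : C.Infinite) : ∃ x ∈ C, P x := by
  obtain ⟨b, hb⟩ := h
  obtain ⟨x, hx, hbx⟩ := hC.exists_gt b
  exact ⟨x, hx, hb x hx hbx⟩

theorem Ev.gt (C : Set ℕ) (k : ℕ) : Ev C fun x => k < x := ⟨k, fun _ _ h => h⟩

/-- eventual quantification commutes with quantification over finite sets -/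
theorem Ev.all {ι : Type*} {C : Set ℕ} {P : ι → ℕ → Prop} {S : Set ι} (hS : S.Finite)
    (h : ∀ i ∈ S, Ev C (P i)) : Ev C fun x => ∀ i ∈ S, P i x := by
  induction S, hS using Set.Finite.induction_on with
  | empty => exact ⟨0, by simp⟩
  | @insert a s _ _ ih =>
    refine ((h a (by simp)).and (ih fun i hi => h i (by simp [hi]))).mono subset_rfl ?_
    rintro x ⟨h1, h2⟩ i hi
    rcases hi with rfl | hi
    · exact h1
    · exact h2 i hi

theorem coh {V B Y : Set ℕ} (hY : Y.Infinite) (hav : Avoid V (join Y B)) (A : ℕ → Set ℕ) :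
    ∃ G, Rsv V B Y G ∧ ∀ i, Ev G (· ∈ A i) ∨ Ev G (· ∉ A i) := by
  obtain ⟨G, hG, -, h⟩ := gen hY hav (fun _ => True) trivial (fun _ _ _ _ => trivial)
    (fun i Y' => Y' ⊆ A i ∨ Y' ⊆ (A i)ᶜ)
    (fun E Y' _ _ hY' => by
      obtain ⟨z, hz⟩ := hY'.2.1.nonempty
      exact ⟨z, hz, trivial⟩)
    (hyp2_of_sig (Sig.const True))
    (fun i Y' h => dj h.2.1 h.2.2 (A i))
  refine ⟨G, hG, fun i => ?_⟩
  obtain ⟨Y', b, h1, h2⟩ := h i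
  exact h1.imp (fun h => ⟨b, fun x hx hb => h (h2 x hx hb)⟩)
    fun h => ⟨b, fun x hx hb => h (h2 x hx hb)⟩

theorem thin {V B Y : Set ℕ} (hY : Y.Infinite) (hav : Avoid V (join Y B)) {T : Set ℕ → Prop}
    (hT0 : T ∅) (hTm : ∀ A A', A' ⊆ A → T A → T A')
    (hTs : Sig (fun _ : Unit => B) fun (l : List ℕ) _ => T (ls l))
    (hext : ∀ F, ls F ⊆ Y → T (ls F) → Ev Y fun z => T (ls (F ++ [z]))) :
    ∃ G, Rsv V B Y G ∧ ∀ L, ls L ⊆ G → T (ls L) := by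
  obtain ⟨G, hG, h, -⟩ := gen hY hav T hT0 hTm (fun _ _ => True)
    (fun E Y' h1 h2 hY' => by
      obtain ⟨z, hz, hz'⟩ := ((hext E h1 h2).mono hY'.1 fun _ h => h).exists hY'.2.1
      exact ⟨z, hz, hz'⟩)
    (hyp2_of_sig hTs)
    (fun i Y' h => ⟨Y', ⟨subset_rfl, h.2⟩, trivial⟩)
  exact ⟨G, hG, h⟩



/-- relation on lists coded by a set of naturals -/
def Rl (R : Set ℕ) (p q : List ℕ) : Prop := Encodable.encode (p, q) ∈ R

def mkR (Q : List ℕ → List ℕ → Prop) : Set ℕ := {c | ∃ p q, c = Encodable.encode (p, q) ∧ Q p q}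

theorem Rl_mkR {Q : List ℕ → List ℕ → Prop} {p q : List ℕ} : Rl (mkR Q) p q ↔ Q p q := by
  constructor
  · rintro ⟨p', q', h, hQ⟩
    have := Encodable.encode_injective h
    simp only [Prod.mk.injEq] at this
    obtain ⟨rfl, rfl⟩ := this
    exact hQ
  · intro h; exact ⟨p, q, rfl, h⟩

def Cls (R : Set ℕ) : Prop :=
  (∀ p q, Rl R p q → Rl R q p) ∧ ∀ p q q', Rl R p q → Rl R p q' → q = q'

def Dcr (p : List ℕ) : Prop := p.Pairwise (· > ·)

def TR (k : ℕ) (R X : Set ℕ) : Prop :=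
  ∀ p q, Dcr p → Dcr q → ls p ⊆ X → ls q ⊆ X → p.length = q.length → p.length ≤ k →
    p.dropLast ≠ q.dropLast → ¬ Rl R p q

theorem TR.mono {k : ℕ} {R X X' : Set ℕ} (h : TR k R X) (hX : X' ⊆ X) : TR k R X' :=
  fun p q h1 h2 h3 h4 => h p q h1 h2 (h3.trans hX) (h4.trans hX)

theorem TR_of_fin {k : ℕ} {R A X : Set ℕ} (h : ∀ L, ls L ⊆ X → TR k R (A ∪ ls L)) :
    TR k R (A ∪ X) := by
  classical
  intro p q h1 h2 h3 h4
  refine h ((p ++ q).filter (· ∈ X)) (fun x hx => ?_) p q h1 h2 (fun x hx => ?_) (fun x hx => ?_)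
  · have := List.mem_filter.1 hx
    simpa using this.2
  · rcases h3 hx with hA | hX
    · exact Or.inl hA
    · exact Or.inr (List.mem_filter.2 ⟨List.mem_append_left _ hx, by simpa using hX⟩)
  · rcases h4 hx with hA | hX
    · exact Or.inl hA
    · exact Or.inr (List.mem_filter.2 ⟨List.mem_append_right _ hx, by simpa using hX⟩)

/-- all lists of length at most `n` from `l` -/
def tupl (l : List ℕ) : ℕ → List (List ℕ)
  | 0 => [[]]
  | n + 1 => [] :: l.flatMap fun x => (tupl l n).map fun p => x :: p

theorem mem_tupl {l p : List ℕ} {n : ℕ} : p ∈ tupl l n ↔ p.length ≤ n ∧ ls p ⊆ ls l := by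
  induction n generalizing p with
  | zero =>
    simp only [tupl, List.mem_singleton, Nat.le_zero, List.length_eq_zero_iff]
    constructor
    · rintro rfl; simp [ls]
    · exact fun h => h.1
  | succ n ih =>
    cases p with
    | nil => simp [tupl, ls]
    | cons x p =>
      simp only [tupl, List.mem_cons, reduceCtorEq, false_or, List.mem_flatMap, List.mem_map,
        List.length_cons, Nat.add_le_add_iff_right, ls_cons, Set.insert_subset_iff, mem_ls]
      constructor
      · rintro ⟨y, hy, q, hq, e⟩
        obtain ⟨rfl, rfl⟩ := List.cons.inj e
        obtain ⟨h1, h2⟩ := ih.1 hq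
        exact ⟨h1, hy, h2⟩
      · rintro ⟨h1, h2, h3⟩
        exact ⟨x, h2, p, ih.2 ⟨h1, h3⟩, rfl⟩

theorem primrec_tupl (n : ℕ) : Primrec fun l => tupl l n := by
  induction n with
  | zero => exact Primrec.const _
  | succ n ih =>
    refine Primrec.list_cons.comp (Primrec.const []) ?_
    refine Primrec.list_flatMap Primrec.id ?_
    refine Primrec.list_map (ih.comp Primrec.fst) ?_
    exact Primrec.list_cons.comp (Primrec.snd.comp Primrec.fst) Primrec.snd

theorem dcr_iff (p : List ℕ) :
    Dcr p ↔ ∀ i < p.length, ∀ j < i, p.getD i 0 < p.getD j 0 := by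
  unfold Dcr
  rw [List.pairwise_iff_getElem]
  constructor
  · intro h i hi j hj
    have := h j i (by omega) hi hj
    simpa [List.getD, hi, show j < p.length by omega] using this
  · intro h j i hj hi hji
    have := h i hi j hji
    simpa [List.getD, hi, hj] using this

theorem primrec_dcr : PrimrecPred Dcr := by
  have hgd : Primrec₂ fun (L : List ℕ) (i : ℕ) => L.getD i 0 := Primrec.list_getD 0
  have h1 : PrimrecRel fun (j : ℕ) (x : ℕ × List ℕ) => x.2.getD x.1 0 < x.2.getD j 0 :=
    Primrec.nat_lt.comp (hgd.comp (Primrec.snd.comp Primrec.snd) (Primrec.fst.comp Primrec.snd))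
      (hgd.comp (Primrec.snd.comp Primrec.snd) Primrec.fst)
  have h2 : PrimrecRel fun (i : ℕ) (p : List ℕ) => ∀ j < i, p.getD i 0 < p.getD j 0 := by
    have h1' := h1.forall_mem_list
    have := PrimrecRel.comp h1' (f := fun x : ℕ × List ℕ => List.range x.1)
      (g := fun x : ℕ × List ℕ => x) (Primrec.list_range.comp Primrec.fst) Primrec.id
    exact this.of_eq fun x => by simp
  have h3 : PrimrecPred fun p : List ℕ => ∀ i < p.length, ∀ j < i, p.getD i 0 < p.getD j 0 := by
    have h2' := h2.forall_mem_list
    have := PrimrecRel.comp h2' (f := fun p : List ℕ => List.range p.length)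
      (g := fun p : List ℕ => p) (Primrec.list_range.comp Primrec.list_length) Primrec.id
    exact this.of_eq fun x => by simp
  exact h3.of_eq fun p => (dcr_iff p).symm

theorem primrec_dropLast : Primrec (List.dropLast : List ℕ → List ℕ) := by
  have : Primrec fun l : List ℕ => l.reverse.tail.reverse :=
    Primrec.list_reverse.comp (Primrec.list_tail.comp Primrec.list_reverse)
  exact this.of_eq fun l => by simp

/-- the decidable side condition in `TR` -/
def Side (x : List ℕ × List ℕ) : Prop :=
  Dcr x.1 ∧ Dcr x.2 ∧ x.1.length = x.2.length ∧ x.1.dropLast ≠ x.2.dropLast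

theorem primrec_side : PrimrecPred Side :=
  (primrec_dcr.comp Primrec.fst).and ((primrec_dcr.comp Primrec.snd).and
    ((Primrec.eq.comp (Primrec.list_length.comp Primrec.fst)
      (Primrec.list_length.comp Primrec.snd)).and
    (Primrec.eq.comp (primrec_dropLast.comp Primrec.fst)
      (primrec_dropLast.comp Primrec.snd)).not))

section
variable {Γ α : Type*} [Primcodable α] {q : Γ → Set ℕ} {R : Γ → Set ℕ}

theorem sig_Rl (hR : ∀ {α : Type} [Primcodable α], Dec q fun (_ : α) γ => R γ)
    {α : Type} [Primcodable α] {f g : α → List ℕ} (hf : Primrec f) (hg : Primrec g) :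
    Sig q fun a γ => Rl (R γ) (f a) (g a) :=
  hR.mem (Primrec.encode.comp (hf.pair hg))

theorem sig_not_Rl (hR : ∀ {α : Type} [Primcodable α], Dec q fun (_ : α) γ => R γ)
    {α : Type} [Primcodable α] {f g : α → List ℕ} (hf : Primrec f) (hg : Primrec g) :
    Sig q fun a γ => ¬ Rl (R γ) (f a) (g a) :=
  hR.not_mem (Primrec.encode.comp (hf.pair hg))

theorem sig_TR (hR : ∀ {α : Type} [Primcodable α], Dec q fun (_ : α) γ => R γ) (k : ℕ) :
    Sig q fun (l : List ℕ) γ => TR k (R γ) (ls l) := by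
  refine (Sig.all (Q := fun (l : List ℕ) (p : List ℕ) γ => ∀ p' ∈ tupl l k,
    ¬ Side (p, p') ∨ ¬ Rl (R γ) p p')
    (Sig.all (Q := fun (x : List ℕ × List ℕ) (p' : List ℕ) γ =>
      ¬ Side (x.2, p') ∨ ¬ Rl (R γ) x.2 p') (Sig.or ?_ ?_)
      ((primrec_tupl k).comp Primrec.fst)) (primrec_tupl k)).congr ?_
  · exact Sig.prim (primrec_side.comp ((Primrec.snd.comp Primrec.fst).pair Primrec.snd)).not
  · exact sig_not_Rl hR (Primrec.snd.comp Primrec.fst) Primrec.snd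
  · intro l γ
    constructor
    · intro h p hp p' hp'
      rw [mem_tupl] at hp hp'
      rw [or_iff_not_imp_left, not_not]
      rintro ⟨h1, h2, h3, h4⟩
      exact h p p' h1 h2 hp.2 hp'.2 h3 hp.1 h4
    · intro h p p' h1 h2 h3 h4 h5 h6 h7
      exact (h p (mem_tupl.2 ⟨h6, h3⟩) p' (mem_tupl.2 ⟨h5 ▸ h6, h4⟩)).resolve_left
        (not_not.2 ⟨h1, h2, h5, h7⟩)

theorem sig_not_TR (hR : ∀ {α : Type} [Primcodable α], Dec q fun (_ : α) γ => R γ) (k : ℕ) :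
    Sig q fun (l : List ℕ) γ => ¬ TR k (R γ) (ls l) := by
  have hsub : ∀ f : List ℕ × (List ℕ × List ℕ) → List ℕ, Primrec f →
      Sig q fun x _ => ls (f x) ⊆ ls x.1 := fun f hf => sig_subset (Dec.ofList Primrec.fst) hf
  refine (Sig.ex (Q := fun (l : List ℕ) (x : List ℕ × List ℕ) γ =>
    Side x ∧ ls x.1 ⊆ ls l ∧ ls x.2 ⊆ ls l ∧ x.1.length ≤ k ∧ Rl (R γ) x.1 x.2) ?_).congr ?_
  · refine (Sig.prim (primrec_side.comp Primrec.snd)).and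
      ((hsub _ (Primrec.fst.comp Primrec.snd)).and
      ((hsub _ (Primrec.snd.comp Primrec.snd)).and ((Sig.prim ?_).and
      (sig_Rl hR (Primrec.fst.comp Primrec.snd) (Primrec.snd.comp Primrec.snd)))))
    exact Primrec.nat_le.comp (Primrec.list_length.comp (Primrec.fst.comp Primrec.snd))
      (Primrec.const k)
  · intro l γ
    unfold TR
    push Not
    constructor
    · rintro ⟨p, p', h1, h2, h3, h4, h5, h6, h7, h8⟩
      exact ⟨(p, p'), ⟨h1, h2, h5, h7⟩, h3, h4, h6, h8⟩
    · rintro ⟨⟨p, p'⟩, ⟨h1, h2, h5, h7⟩, h3, h4, h6, h8⟩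
      exact ⟨p, p', h1, h2, h3, h4, h5, h6, h7, h8⟩

theorem sig_not_Cls (hR : ∀ {α : Type} [Primcodable α], Dec q fun (_ : α) γ => R γ)
    {α : Type} [Primcodable α] :
    Sig q fun (_ : α) γ => ¬ Cls (R γ) := by
  refine ((Sig.ex (Q := fun (_ : α) (x : List ℕ × List ℕ) γ =>
    Rl (R γ) x.1 x.2 ∧ ¬ Rl (R γ) x.2 x.1) ?_).or
    (Sig.ex (Q := fun (_ : α) (x : List ℕ × List ℕ × List ℕ) γ =>
    Rl (R γ) x.1 x.2.1 ∧ Rl (R γ) x.1 x.2.2 ∧ x.2.1 ≠ x.2.2) ?_)).congr ?_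
  · exact (sig_Rl hR (Primrec.fst.comp Primrec.snd) (Primrec.snd.comp Primrec.snd)).and
      (sig_not_Rl hR (Primrec.snd.comp Primrec.snd) (Primrec.fst.comp Primrec.snd))
  · have h1 : Primrec fun x : α × (List ℕ × List ℕ × List ℕ) => x.2.1 :=
      Primrec.fst.comp Primrec.snd
    have h2 : Primrec fun x : α × (List ℕ × List ℕ × List ℕ) => x.2.2.1 :=
      Primrec.fst.comp (Primrec.snd.comp Primrec.snd)
    have h3 : Primrec fun x : α × (List ℕ × List ℕ × List ℕ) => x.2.2.2 :=
      Primrec.snd.comp (Primrec.snd.comp Primrec.snd)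
    exact (sig_Rl hR h1 h2).and ((sig_Rl hR h1 h3).and (Sig.prim (Primrec.eq.comp h2 h3).not))
  · intro _ γ
    unfold Cls
    rw [not_and_or]
    push Not
    simp [Prod.exists]

end

theorem dcr_insert {z : ℕ} {F : Set ℕ} (hz : ∀ x ∈ F, x < z) {p : List ℕ} (hp : Dcr p)
    (hs : ls p ⊆ insert z F) : ls p ⊆ F ∨ ∃ p', p = z :: p' ∧ Dcr p' ∧ ls p' ⊆ F := by
  cases p with
  | nil => left; simp [ls]
  | cons x p =>
    rw [Dcr, List.pairwise_cons] at hp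
    have hx := hs (List.mem_cons_self : x ∈ x :: p)
    have hp' : ∀ y ∈ p, y ∈ F := fun y hy => by
      rcases hs (List.mem_cons_of_mem _ hy : y ∈ x :: p) with rfl | h
      · have h1 := hp.1 _ hy
        rcases hx with rfl | hx
        · omega
        · have := hz _ hx; omega
      · exact h
    rcases hx with rfl | hx
    · exact Or.inr ⟨p, rfl, hp.2, hp'⟩
    · left
      rw [ls_cons]
      exact Set.insert_subset hx hp'

theorem ext {n : ℕ} {R C : Set ℕ} (hR : Cls R) (l : List ℕ) (h : TR n R (ls l))
    (hlim : ∀ p q, Dcr p → Dcr q → ls p ⊆ ls l → ls q ⊆ ls l → p.length = q.length →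
      p.length + 1 ≤ n → p.dropLast ≠ q.dropLast → Ev C fun z => ¬ Rl R (z :: p) (z :: q)) :
    Ev C fun z => TR n R (insert z (ls l)) := by
  have hfin : {p : List ℕ | p.length ≤ n ∧ ls p ⊆ ls l}.Finite :=
    (List.finite_toSet (tupl l n)).subset fun p hp => mem_tupl.2 hp
  have e1 : Ev C fun z => ∀ p ∈ {p : List ℕ | p.length ≤ n ∧ ls p ⊆ ls l},
      ∀ q, ¬ Rl R p (z :: q) := by
    refine Ev.all hfin fun p _ => ?_
    by_cases hex : ∃ z q, Rl R p (z :: q)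
    · obtain ⟨z, q, hzq⟩ := hex
      refine ⟨z, fun z' _ hz q' hq' => ?_⟩
      have := hR.2 _ _ _ hzq hq'
      rw [(List.cons.inj this).1] at hz
      omega
    · push Not at hex
      exact ⟨0, fun z _ _ q => hex z q⟩
  have e2 : Ev C fun z => ∀ x ∈ {p : List ℕ | p.length ≤ n ∧ ls p ⊆ ls l} ×ˢ
      {p : List ℕ | p.length ≤ n ∧ ls p ⊆ ls l}, (Dcr x.1 ∧ Dcr x.2 ∧ x.1.length = x.2.length ∧
      x.1.length + 1 ≤ n ∧ x.1.dropLast ≠ x.2.dropLast) → ¬ Rl R (z :: x.1) (z :: x.2) := by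
    refine Ev.all (hfin.prod hfin) fun x hx => ?_
    by_cases hc : Dcr x.1 ∧ Dcr x.2 ∧ x.1.length = x.2.length ∧
      x.1.length + 1 ≤ n ∧ x.1.dropLast ≠ x.2.dropLast
    · exact (hlim x.1 x.2 hc.1 hc.2.1 hx.1.2 hx.2.2 hc.2.2.1 hc.2.2.2.1 hc.2.2.2.2).mono
        subset_rfl fun z h _ => h
    · exact ⟨0, fun z _ _ h => absurd h hc⟩
  obtain ⟨b, hb⟩ := ls_bdd l
  refine ((Ev.gt C b).and (e1.and e2)).mono subset_rfl ?_
  rintro z ⟨hz, H1, H2⟩ p q hp hq hps hqs hlen hk hd hRl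
  have hz' : ∀ x ∈ ls l, x < z := fun x hx => lt_of_le_of_lt (hb x hx) hz
  rcases dcr_insert hz' hp hps with hps | ⟨p', rfl, hp', hps'⟩
  · rcases dcr_insert hz' hq hqs with hqs | ⟨q', rfl, hq', hqs'⟩
    · exact h p q hp hq hps hqs hlen hk hd hRl
    · exact H1 p ⟨hk, hps⟩ _ hRl
  · rcases dcr_insert hz' hq hqs with hqs | ⟨q', rfl, hq', hqs'⟩
    · exact H1 q ⟨hlen ▸ hk, hqs⟩ _ (hR.1 _ _ hRl)
    · simp only [List.length_cons] at hlen hk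
      have hl : p'.length = q'.length := by omega
      refine H2 (p', q') ⟨⟨show p'.length ≤ n by omega, hps'⟩,
        ⟨show q'.length ≤ n by omega, hqs'⟩⟩ ⟨hp', hq', hl, hk, ?_⟩ hRl
      intro he
      apply hd
      cases p' with
      | nil =>
        cases q' with
        | nil => rfl
        | cons _ _ => simp at hl
      | cons a p' =>
        cases q' with
        | nil => simp at hl
        | cons c q' =>
          rw [List.dropLast_cons₂, List.dropLast_cons₂, he]

theorem dropLast_eq_of_short {p q : List ℕ} (h : p.length = q.length) (h1 : p.length ≤ 1) :
    p.dropLast = q.dropLast := by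
  have e : ∀ p : List ℕ, p.length ≤ 1 → p.dropLast = [] := fun p hp => by
    apply List.eq_nil_of_length_eq_zero; simp; omega
  rw [e p h1, e q (h ▸ h1)]

/-- limit relation -/
def lim (R C : Set ℕ) : Set ℕ := mkR fun p q => Ev C fun z => Rl R (z :: p) (z :: q)

theorem Rl_lim {R C : Set ℕ} {p q : List ℕ} :
    Rl (lim R C) p q ↔ Ev C fun z => Rl R (z :: p) (z :: q) := Rl_mkR

def Coh (R C : Set ℕ) : Prop := ∀ p q, (Ev C fun z => Rl R (z :: p) (z :: q)) ∨
  Ev C fun z => ¬ Rl R (z :: p) (z :: q)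

theorem Coh.lim {R C : Set ℕ} (h : Coh R C) {p q : List ℕ} (hn : ¬ Rl (lim R C) p q) :
    Ev C fun z => ¬ Rl R (z :: p) (z :: q) :=
  (h p q).resolve_left fun h' => hn (Rl_lim.2 h')

theorem exists_coh {V B Y : Set ℕ} (hY : Y.Infinite) (hav : Avoid V (join Y B)) (R : Set ℕ) :
    ∃ C, Rsv V B Y C ∧ Coh R C := by
  obtain ⟨C, hC, h⟩ := coh hY hav fun i => {z | ∃ p q, Encodable.encode (p, q) = i ∧
    Rl R (z :: p) (z :: q)}
  refine ⟨C, hC, fun p q => ?_⟩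
  have e : ∀ z, (z ∈ {z | ∃ p' q', Encodable.encode (p', q') = Encodable.encode (p, q) ∧
    Rl R (z :: p') (z :: q')}) ↔ Rl R (z :: p) (z :: q) := by
    intro z
    constructor
    · rintro ⟨p', q', h, hQ⟩
      have := Encodable.encode_injective h
      simp only [Prod.mk.injEq] at this
      obtain ⟨rfl, rfl⟩ := this
      exact hQ
    · intro h; exact ⟨p, q, rfl, h⟩
  refine (h (Encodable.encode (p, q))).imp (fun h => h.mono subset_rfl fun z => (e z).1)
    fun h => h.mono subset_rfl fun z hz hz' => hz ((e z).2 hz')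

theorem Cls.lim {R C : Set ℕ} (h : Cls R) (hC : C.Infinite) : Cls (lim R C) := by
  constructor
  · intro p q hpq
    exact Rl_lim.2 ((Rl_lim.1 hpq).mono subset_rfl fun z hz => h.1 _ _ hz)
  · intro p q q' hq hq'
    obtain ⟨z, _, h1, h2⟩ := ((Rl_lim.1 hq).and (Rl_lim.1 hq')).exists hC
    exact (List.cons.inj (h.2 _ _ _ h1 h2)).2



theorem ls_stem (E F : List ℕ) (z : ℕ) :
    ls E ∪ ls (F ++ [z]) = insert z (ls (E ++ F)) := by
  rw [ls_append, ls_append, ls_cons, ls_nil]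
  ext x; simp

theorem step {V B Y R : Set ℕ} {k : ℕ} (hY : Y.Infinite) (hav : Avoid V (join Y B))
    (hRB : Red R B) (hR : Cls R) (E : List ℕ) (hE : TR k R (ls E))
    (hlim : ∀ p q, ls p ⊆ ls E ∪ Y → ls q ⊆ ls E ∪ Y → Dcr p → Dcr q → p.length = q.length →
      p.length + 1 ≤ k → p.dropLast ≠ q.dropLast → Ev Y fun z => ¬ Rl R (z :: p) (z :: q)) :
    ∃ G, Rsv V B Y G ∧ TR k R (ls E ∪ G) := by
  obtain ⟨G, hG, h⟩ := thin (T := fun F => TR k R (ls E ∪ F)) hY hav (by simpa using hE)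
    (fun A A' hA h => h.mono (Set.union_subset_union_right _ hA)) (by
      have hd : ∀ {α : Type} [Primcodable α], Dec (fun _ : Unit => B) fun (_ : α) _ => R :=
        fun {α} _ => hRB.dec Dec.id
      refine ((sig_TR hd k).comp (f := fun F => E ++ F)
        (Primrec.list_append.comp (Primrec.const E) Primrec.id)).congr fun l _ => ?_
      rw [ls_append]) (by
      intro F hF hT
      rw [← ls_append] at hT
      have hs : ls (E ++ F) ⊆ ls E ∪ Y := by
        rw [ls_append]; exact Set.union_subset_union_right _ hF
      refine (ext (C := Y) hR _ hT fun p q h1 h2 h3 h4 h5 h6 h7 =>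
        hlim p q (h3.trans hs) (h4.trans hs) h1 h2 h5 h6 h7).mono subset_rfl fun z hz => ?_
      rw [ls_stem]; exact hz)
  exact ⟨G, hG, TR_of_fin h⟩

def Solver (V : Set ℕ) (k : ℕ) : Prop :=
  ∀ (B : Set ℕ) (E : List ℕ) (Y R : Set ℕ), Y.Infinite → Avoid V (join R (join Y B)) → Cls R →
    (∀ z ∈ Y, TR k R (insert z (ls E))) → ∃ G, Rsv V B Y G ∧ TR k R (ls E ∪ G)

theorem str {V : Set ℕ} {k : ℕ} (hsol : Solver V k) {B C g : Set ℕ} (hC : C.Infinite)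
    (hav : Avoid V (join C B)) (hg : Cls g) (E : List ℕ) (hE : TR k g (ls E))
    (good : ∀ l, TR k g (ls l) → Ev C fun z => TR k g (insert z (ls l))) :
    ∃ G, Rsv V B C G ∧ TR k g (ls E ∪ G) := by
  obtain ⟨G, hG, h, -⟩ := gen hC hav (fun F => TR k g (ls E ∪ F)) (by simpa using hE)
    (fun A A' hA h => h.mono (Set.union_subset_union_right _ hA)) (fun _ _ => True)
    (by
      intro F Y _ hT hY
      rw [← ls_append] at hT
      obtain ⟨z, hz, h⟩ := ((good _ hT).mono hY.1 fun _ h => h).exists hY.2.1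
      exact ⟨z, hz, by rw [ls_stem]; exact h⟩)
    (by
      intro F0 Y D _ hT hY hD
      rw [← ls_append] at hT
      obtain ⟨b, hb⟩ := good _ hT
      let Y1 := Y ∩ {x | b < x}
      have hY1 : Rsv V B C Y1 := hY.trunc b
      let E1 := E ++ F0
      have hBd : ∀ {α : Type} [Primcodable α],
          Dec (fun R => join R (join Y1 B)) fun (_ : α) _ => B :=
        fun {α} _ => Dec.right (A := fun _ => Y1) (Dec.right (A := fun R => R) Dec.id)
      have hYd : ∀ {α : Type} [Primcodable α],
          Dec (fun R => join R (join Y1 B)) fun (_ : α) _ => Y1 :=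
        fun {α} _ => Dec.left (B := fun _ => B) (Dec.right (A := fun R => R) Dec.id)
      have hRd : ∀ {α : Type} [Primcodable α],
          Dec (fun R => join R (join Y1 B)) fun (_ : α) R => R :=
        fun {α} _ => Dec.left (A := fun R => R) Dec.id
      have hP : Sig (fun R => join R (join Y1 B)) fun (n : ℕ) R =>
          ¬ Cls R ∨ (∃ z, z ∈ Y1 ∧ ¬ TR k R (ls (z :: E1))) ∨
          ∃ F : List ℕ, ls F ⊆ Y1 ∧ TR k R (ls (E1 ++ F)) ∧
            ∃ m, D n (res (join (ls (F0 ++ F)) B) m) := by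
        refine (sig_not_Cls hRd).or (Sig.or ?_ ?_)
        · refine Sig.ex (Q := fun _ z R => z ∈ Y1 ∧ ¬ TR k R (ls (z :: E1))) ?_
          exact (hYd.mem Primrec.snd).and ((sig_not_TR hRd k).comp
            (Primrec.list_cons.comp Primrec.snd (Primrec.const E1)))
        · refine Sig.ex (Q := fun n F R => ls F ⊆ Y1 ∧ TR k R (ls (E1 ++ F)) ∧
            ∃ m, D n (res (join (ls (F0 ++ F)) B) m)) ?_
          exact (sig_subset hYd Primrec.snd).and (((sig_TR hRd k).comp
            (Primrec.list_append.comp (Primrec.const E1) Primrec.snd)).and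
            (sig_D hD hBd Primrec.fst
              (Primrec.list_append.comp (Primrec.const F0) Primrec.snd)))
      rcases question hY1.2.2 hP with ⟨n, hn, h⟩ | ⟨n, hn, R, hR, hA⟩
      · refine ⟨n, Or.inl ⟨hn, ?_⟩⟩
        rcases h g with h | ⟨z, hz, h⟩ | ⟨F, hF, hTR, m, hm⟩
        · exact absurd hg h
        · refine absurd ?_ h
          rw [ls_cons]
          exact hb z (hY1.1 hz) hz.2
        · refine ⟨F, fun x hx => (hF hx).1, ?_, m, hm⟩
          change TR k g (ls E ∪ ls (F0 ++ F))
          rwa [← ls_append, ← List.append_assoc]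
      · push Not at hR
        obtain ⟨h1, h2, h3⟩ := hR
        obtain ⟨Y', hY', hTR⟩ := hsol B E1 Y1 R hY1.2.1 hA h1 fun z hz => by
          have := h2 z hz
          rwa [ls_cons] at this
        refine ⟨n, Or.inr ⟨hn, Y', ⟨hY'.1.trans Set.inter_subset_left, hY'.2⟩, ?_⟩⟩
        intro F hF _ m
        refine h3 F (hF.trans hY'.1) (hTR.mono ?_) m
        rw [ls_append]
        exact Set.union_subset_union_right _ hF)
    (fun i Y' h => ⟨Y', ⟨subset_rfl, h.2⟩, trivial⟩)
  exact ⟨G, hG, TR_of_fin h⟩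

theorem avoid_swap {V R Y B : Set ℕ} (h : Avoid V (join R (join Y B))) :
    Avoid V (join Y (join R B)) :=
  h.mono (((red_join_left Y B).trans (red_join_right R _)).join
    ((red_join_left R _).join ((red_join_right Y B).trans (red_join_right R _))))

theorem Rsv.drop {V R Y B G : Set ℕ} (h : Rsv V (join R B) Y G) : Rsv V B Y G :=
  ⟨h.1, h.2.1, h.2.2.mono ((red_join_left _ _).join
    ((red_join_right R B).trans (red_join_right _ _)))⟩

theorem solver2 (V : Set ℕ) : Solver V 2 := by
  intro B E Y R hY hav hR hz
  obtain ⟨z, hzY⟩ := hY.nonempty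
  obtain ⟨G, hG, h⟩ := step hY (avoid_swap hav) (red_join_left R B) hR E
    ((hz z hzY).mono (Set.subset_insert _ _)) fun p q _ _ _ _ h5 h6 h7 =>
      absurd (dropLast_eq_of_short h5 (by omega)) h7
  exact ⟨G, hG.drop, h⟩

theorem solver3 (V : Set ℕ) : Solver V 3 := by
  intro B E Y R hY hav hR hz
  obtain ⟨z, hzY⟩ := hY.nonempty
  obtain ⟨b, hb⟩ := ls_bdd E
  obtain ⟨C, hC, hcoh⟩ := exists_coh hY (avoid_swap hav) R
  have hg := hR.lim hC.2.1
  have hE2 : TR 2 (lim R C) (ls E) := by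
    intro p q h1 h2 h3 h4 h5 h6 h7 hRl
    obtain ⟨z, hzC, hz1, hz2⟩ := ((Rl_lim.1 hRl).and (Ev.gt C b)).exists hC.2.1
    have hdc : ∀ p, Dcr p → ls p ⊆ ls E → Dcr (z :: p) := fun p hp hs =>
      List.pairwise_cons.2 ⟨fun x hx => lt_of_le_of_lt (hb x (hs hx)) hz2, hp⟩
    have hsb : ∀ p, ls p ⊆ ls E → ls (z :: p) ⊆ insert z (ls E) := fun p hp => by
      rw [ls_cons]; exact Set.insert_subset_insert hp
    refine hz z (hC.1 hzC) (z :: p) (z :: q) (hdc p h1 h3) (hdc q h2 h4) (hsb p h3) (hsb q h4)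
      (by simp [h5]) (by simp; omega) ?_ hz1
    intro he
    apply h7
    cases p with
    | nil =>
      cases q with
      | nil => rfl
      | cons _ _ => simp at h5
    | cons a p =>
      cases q with
      | nil => simp at h5
      | cons c q =>
        rw [List.dropLast_cons₂, List.dropLast_cons₂] at he
        exact (List.cons.inj he).2
  obtain ⟨Y2, hY2, hTR⟩ := str (solver2 V) hC.2.1 hC.2.2 hg E hE2 fun l hl =>
    ext hg l hl fun p q _ _ _ _ h5 h6 h7 => absurd (dropLast_eq_of_short h5 (by omega)) h7
  obtain ⟨G, hG, h⟩ := step hY2.2.1 hY2.2.2 (red_join_left R B) hR E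
    ((hz z hzY).mono (Set.subset_insert _ _)) fun p q h3 h4 h1 h2 h5 h6 h7 =>
      (hcoh.lim (hTR p q h1 h2 h3 h4 h5 (by omega) h7)).mono hY2.1 fun _ h => h
  exact ⟨G, (hC.sub (hY2.sub hG)).drop, h⟩

theorem final {V Z R : Set ℕ} (hav : Avoid V Z) (hRZ : Red R Z) (hR : Cls R)
    (hlen : ∀ p q, Rl R p q → p.length = 4) :
    ∃ X : Set ℕ, X.Infinite ∧ TR 4 R X ∧ Avoid V (join X Z) := by
  have hu : Avoid V (join Set.univ Z) := hav.mono (Red.join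
    ⟨(Sig.const True).congr (by simp), (Sig.const False).congr (by simp)⟩ (Red.refl Z))
  obtain ⟨C1, hC1, coh1⟩ := exists_coh Set.infinite_univ hu R
  have hS := hR.lim hC1.2.1
  obtain ⟨C, hC, coh2⟩ := exists_coh hC1.2.1 hC1.2.2 (lim R C1)
  have hS2 := hS.lim hC.2.1
  have len1 : ∀ p q, Rl (lim R C1) p q → p.length = 3 := fun p q h => by
    obtain ⟨z, _, hz⟩ := (Rl_lim.1 h).exists hC1.2.1
    simpa using hlen _ _ hz
  have len2 : ∀ p q, Rl (lim (lim R C1) C) p q → p.length = 2 := fun p q h => by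
    obtain ⟨z, _, hz⟩ := (Rl_lim.1 h).exists hC.2.1
    simpa using len1 _ _ hz
  let g : Set ℕ := lim R C1 ∪ lim (lim R C1) C
  have hgl : ∀ p q, Rl g p q ↔ Rl (lim R C1) p q ∨ Rl (lim (lim R C1) C) p q := fun _ _ => Iff.rfl
  have hg : Cls g := by
    constructor
    · intro p q h
      exact h.imp (hS.1 p q) (hS2.1 p q)
    · rintro p q q' (h | h) (h' | h')
      · exact hS.2 _ _ _ h h'
      · have a1 := len1 _ _ h; have a2 := len2 _ _ h'; omega
      · have a1 := len2 _ _ h; have a2 := len1 _ _ h'; omega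
      · exact hS2.2 _ _ _ h h'
  have hnil : ∀ k R, TR k R (ls []) := by
    intro k R p q _ _ h3 h4 _ _ h7
    rw [ls_nil, Set.subset_empty_iff] at h3 h4
    have e : ∀ p, ls p = ∅ → p = [] := fun p hp => List.eq_nil_iff_forall_not_mem.2 fun x hx => by
      have : x ∈ ls p := hx
      rw [hp] at this; exact this
    rw [e p h3, e q h4] at h7
    exact absurd rfl h7
  obtain ⟨Y, hY, hTR⟩ := str (solver3 V) hC.2.1 hC.2.2 hg [] (hnil _ _) fun l hl =>
    ext hg l hl fun p q h1 h2 h3 h4 h5 h6 h7 => by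
      have hn := hl p q h1 h2 h3 h4 h5 (by omega) h7
      have hp2 : p.length = 2 := by
        by_contra hne
        exact h7 (dropLast_eq_of_short h5 (by omega))
      refine (coh2.lim fun h => hn (Or.inr h)).mono subset_rfl fun z hz => ?_
      rintro (h | h)
      · exact hz h
      · have := len2 _ _ h
        simp at this; omega
  obtain ⟨X, hX, h⟩ := step hY.2.1 hY.2.2 hRZ hR [] (hnil 4 _) fun p q h3 h4 h1 h2 h5 h6 h7 =>
      (coh1.lim fun h => hTR p q h1 h2 h3 h4 h5 (by omega) h7 (Or.inl h)).mono
        (hY.1.trans hC.1) fun _ h => h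
  refine ⟨X, hX.2.1, ?_, hX.2.2⟩
  rwa [ls_nil, Set.empty_union] at h

/-- colour of a decreasing quadruple -/
def col (F : ℕ → ℕ) (p : List ℕ) : ℕ :=
  F (Nat.pair (p.getD 3 0) (Nat.pair (p.getD 2 0) (Nat.pair (p.getD 1 0) (p.getD 0 0))))

def Pre (x : List ℕ × List ℕ) : Prop :=
  Dcr x.1 ∧ Dcr x.2 ∧ x.1.length = 4 ∧ x.2.length = 4 ∧ x.1 ≠ x.2

theorem primrec_pre : PrimrecPred Pre :=
  (primrec_dcr.comp Primrec.fst).and ((primrec_dcr.comp Primrec.snd).and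
    ((Primrec.eq.comp (Primrec.list_length.comp Primrec.fst) (Primrec.const 4)).and
    ((Primrec.eq.comp (Primrec.list_length.comp Primrec.snd) (Primrec.const 4)).and
    (Primrec.eq.comp Primrec.fst Primrec.snd).not)))

theorem red_col {Z : Set ℕ} {F : ℕ → ℕ} (hF : FunRecIn Z F) :
    Red (mkR fun p q => Pre (p, q) ∧ col F p = col F q) Z := by
  have h0 : Sig (fun _ : Unit => Z) fun (x : ℕ × ℕ) _ => x.2 = F x.1 :=
    (sig_of_rec hF).congr fun x _ => Part.mem_some_iff.symm
  have hgd : ∀ i, Primrec fun L : List ℕ => L.getD i 0 := fun i =>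
    (Primrec.list_getD 0).comp Primrec.id (Primrec.const i)
  have h1 : Sig (fun _ : Unit => Z) fun (x : List ℕ × ℕ) _ => x.2 = col F x.1 := by
    refine h0.comp (f := fun x : List ℕ × ℕ => (Nat.pair (x.1.getD 3 0)
      (Nat.pair (x.1.getD 2 0) (Nat.pair (x.1.getD 1 0) (x.1.getD 0 0))), x.2)) ?_
    refine (Primrec₂.natPair.comp ((hgd 3).comp Primrec.fst) (Primrec₂.natPair.comp
      ((hgd 2).comp Primrec.fst) (Primrec₂.natPair.comp ((hgd 1).comp Primrec.fst)
      ((hgd 0).comp Primrec.fst)))).pair Primrec.snd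
  have hof : Primrec (Denumerable.ofNat (List ℕ × List ℕ)) := Primrec.ofNat _
  have hm : ∀ c, c ∈ (mkR fun p q => Pre (p, q) ∧ col F p = col F q) ↔
      Pre (Denumerable.ofNat (List ℕ × List ℕ) c) ∧
      col F (Denumerable.ofNat (List ℕ × List ℕ) c).1 =
      col F (Denumerable.ofNat (List ℕ × List ℕ) c).2 := by
    intro c
    constructor
    · rintro ⟨p, q, rfl, h⟩
      rwa [Denumerable.ofNat_encode]
    · intro h
      exact ⟨_, _, (Denumerable.encode_ofNat c).symm, h⟩
  have hfst : Primrec fun x : ℕ × ℕ × ℕ => (Denumerable.ofNat (List ℕ × List ℕ) x.1).1 :=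
    Primrec.fst.comp (hof.comp Primrec.fst)
  have hsnd : Primrec fun x : ℕ × ℕ × ℕ => (Denumerable.ofNat (List ℕ × List ℕ) x.1).2 :=
    Primrec.snd.comp (hof.comp Primrec.fst)
  have hv : Primrec fun x : ℕ × ℕ × ℕ => x.2.1 := Primrec.fst.comp Primrec.snd
  have hw : Primrec fun x : ℕ × ℕ × ℕ => x.2.2 := Primrec.snd.comp Primrec.snd
  constructor
  · refine ((Sig.prim (primrec_pre.comp hof)).and (Sig.ex (Q := fun c (v : ℕ × ℕ) _ =>
      v.1 = col F (Denumerable.ofNat (List ℕ × List ℕ) c).1 ∧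
      v.2 = col F (Denumerable.ofNat (List ℕ × List ℕ) c).2 ∧ v.1 = v.2)
      ((h1.comp (hfst.pair hv)).and ((h1.comp (hsnd.pair hw)).and
        (Sig.prim (Primrec.eq.comp hv hw)))))).congr fun c _ => ?_
    rw [hm]
    refine and_congr_right fun _ => ?_
    constructor
    · intro h; exact ⟨(_, _), rfl, rfl, h⟩
    · rintro ⟨⟨v, w⟩, e1, e2, e3⟩
      exact e1.symm.trans (e3.trans e2)
  · refine ((Sig.prim (primrec_pre.comp hof).not).or (Sig.ex (Q := fun c (v : ℕ × ℕ) _ =>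
      v.1 = col F (Denumerable.ofNat (List ℕ × List ℕ) c).1 ∧
      v.2 = col F (Denumerable.ofNat (List ℕ × List ℕ) c).2 ∧ v.1 ≠ v.2)
      ((h1.comp (hfst.pair hv)).and ((h1.comp (hsnd.pair hw)).and
        (Sig.prim (Primrec.eq.comp hv hw).not))))).congr fun c _ => ?_
    rw [hm, not_and_or]
    refine or_congr_right ?_
    constructor
    · intro h; exact ⟨(_, _), rfl, rfl, h⟩
    · rintro ⟨⟨v, w⟩, e1, e2, e3⟩ h
      exact e3 (e1.trans (h.trans e2.symm))

theorem len4 {p : List ℕ} (h : p.length = 4) : ∃ a b c d, p = [a, b, c, d] := by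
  match p, h with
  | [a, b, c, d], _ => exact ⟨a, b, c, d, rfl⟩

theorem cls_col {f : ℕ → ℕ → ℕ → ℕ → ℕ} (hb : Bounded2Quads f) {F : ℕ → ℕ}
    (hF : ∀ x y z w : ℕ, x < y → y < z → z < w →
      F (Nat.pair x (Nat.pair y (Nat.pair z w))) = f x y z w) :
    Cls (mkR fun p q => Pre (p, q) ∧ col F p = col F q) := by
  constructor
  · intro p q h
    rw [Rl_mkR] at h ⊢
    obtain ⟨⟨h1, h2, h3, h4, h5⟩, h6⟩ := h
    exact ⟨⟨h2, h1, h4, h3, h5.symm⟩, h6.symm⟩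
  · intro p q q' h h'
    rw [Rl_mkR] at h h'
    obtain ⟨⟨h1, h2, h3, h4, h5⟩, h6⟩ := h
    obtain ⟨⟨-, h2', -, h4', h5'⟩, h6'⟩ := h'
    by_contra hne
    have key : ∀ r, Dcr r → r.length = 4 → col F r = col F p →
        (r.getD 3 0, r.getD 2 0, r.getD 1 0, r.getD 0 0) ∈ {t : ℕ × ℕ × ℕ × ℕ |
          t.1 < t.2.1 ∧ t.2.1 < t.2.2.1 ∧ t.2.2.1 < t.2.2.2 ∧
          f t.1 t.2.1 t.2.2.1 t.2.2.2 = col F p} := by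
      intro r hr hl hc
      obtain ⟨a, b, c, d, rfl⟩ := len4 hl
      simp only [Dcr, List.pairwise_cons, List.mem_cons, List.not_mem_nil, or_false] at hr
      obtain ⟨r1, r2, r3, -⟩ := hr
      have e1 := r1 b (by simp)
      have e2 := r2 c (by simp)
      have e3 := r3 d (by simp)
      refine ⟨e3, e2, e1, ?_⟩
      rw [← hc]
      exact (hF d c b a e3 e2 e1).symm
    have inj : ∀ r s : List ℕ, r.length = 4 → s.length = 4 → r ≠ s →
        (r.getD 3 0, r.getD 2 0, r.getD 1 0, r.getD 0 0) ≠
        (s.getD 3 0, s.getD 2 0, s.getD 1 0, s.getD 0 0) := by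
      intro r s hr hs hne h
      obtain ⟨a, b, c, d, rfl⟩ := len4 hr
      obtain ⟨a', b', c', d', rfl⟩ := len4 hs
      apply hne
      simp at h
      obtain ⟨rfl, rfl, rfl, rfl⟩ := h
      rfl
    have k1 := key p h1 h3 rfl
    have k2 := key q h2 h4 h6.symm
    have k3 := key q' h2' h4' h6'.symm
    have i1 := inj p q h3 h4 h5
    have i2 := inj p q' h3 h4' h5'
    have i3 := inj q q' h4 h4' hne
    have := (Set.encard_le_encard (Set.insert_subset k1 (Set.insert_subset k2
      (Set.singleton_subset_iff.2 k3)))).trans (hb (col F p))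
    rw [Set.encard_eq_three.2 ⟨_, _, _, i1, i2, i3, rfl⟩] at this
    exact absurd this (by decide)

/-- if `W ≰_T Z` and `f` is a 2-bounded coloring of `[ℕ]⁴` computable
relative to an oracle for `Z`, then there is an infinite tail `f`-rainbow `X` with
`W ≰_T X ⊕ Z`. -/
theorem statement12 (W Z : Set ℕ) (hWZ : ¬ TuringLE W Z) (f : ℕ → ℕ → ℕ → ℕ → ℕ)
    (hbounded : Bounded2Quads f)
    (hcomp : ∃ F : ℕ → ℕ, FunRecIn Z F ∧ ∀ x y z w : ℕ, x < y → y < z → z < w →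
      F (Nat.pair x (Nat.pair y (Nat.pair z w))) = f x y z w) :
    ∃ X : Set ℕ, X.Infinite ∧ TailRainbow4On f X ∧ ¬ TuringLE W (join X Z) := by
  obtain ⟨F, hF, hFf⟩ := hcomp
  have hav : Avoid (join W Wᶜ) Z := fun h => hWZ (turing_of_sig h)
  obtain ⟨X, hX, hTR, hA⟩ := final hav (red_col hF) (cls_col hbounded hFf)
    (fun p q h => (Rl_mkR.1 h).1.2.2.1)
  refine ⟨X, hX, ?_, fun h => not_avoid_of_turing h hA⟩
  intro x₀ x₁ x₂ x₃ y₀ y₁ y₂ y₃ a0 a1 a2 a3 b0 b1 b2 b3 l1 l2 l3 m1 m2 m3 hne he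
  have d1 : Dcr [x₃, x₂, x₁, x₀] := by
    simp [Dcr]; omega
  have d2 : Dcr [y₃, y₂, y₁, y₀] := by
    simp [Dcr]; omega
  have hne' : [x₃, x₂, x₁, x₀].dropLast ≠ [y₃, y₂, y₁, y₀].dropLast := by
    intro h
    apply hne
    simp at h
    obtain ⟨rfl, rfl, rfl⟩ := h
    rfl
  refine hTR [x₃, x₂, x₁, x₀] [y₃, y₂, y₁, y₀] d1 d2 ?_ ?_ rfl (by simp) hne'
    (Rl_mkR.2 ⟨⟨d1, d2, rfl, rfl, fun h => hne' (congrArg List.dropLast h)⟩, ?_⟩)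
  · intro x hx
    simp [ls] at hx
    rcases hx with rfl | rfl | rfl | rfl <;> assumption
  · intro x hx
    simp [ls] at hx
    rcases hx with rfl | rfl | rfl | rfl <;> assumption
  · have e1 := hFf x₀ x₁ x₂ x₃ l1 l2 l3
    have e2 := hFf y₀ y₁ y₂ y₃ m1 m2 m3
    simpa [col, e1, e2] using he



end RRT
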